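/- arXiv:2411.03803 — 5 statements merged into one kernel-verified Lean document; each statement's English description precedes it below -/
import Mathlib

section
/- The maximal topological crystal Γ̃ over a finite connected graph Γ₀ contains no self-loops: for every edge (e,h) of Γ̃ one has o(e,h) ≠ t(e,h). Equivalently, θ(e) ≠ 0 for every e ∈ E₀ with o(e) = t(e). -/
/-- A graph in the sense of the paper: a set `V` of vertices, a set `E` of
(oriented) edges, an origin map `o : E → V` and a fixed-point-free involution
`neg : E → E` (edge reversal). -/
structure DGraph (V E : Type) where
  o : E → V
  neg : E → E
  neg_ne : ∀ e, neg e ≠ e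
  neg_neg : ∀ e, neg (neg e) = e

namespace DGraph

variable {V E : Type}

/-- Terminal vertex of an edge. -/
def t (G : DGraph V E) (e : E) : V := G.o (G.neg e)

/-- A path is a nonempty finite sequence of concatenated edges. -/
def IsPath (G : DGraph V E) (ξ : List E) : Prop :=
  ξ ≠ [] ∧ ξ.Chain' (fun e f => G.o f = G.t e)

/-- Initial vertex of a (nonempty) list of edges, as an option. -/
def startO (G : DGraph V E) (ξ : List E) : Option V := ξ.head?.map G.o

/-- Terminal vertex of a (nonempty) list of edges, as an option. -/
def endO (G : DGraph V E) (ξ : List E) : Option V := ξ.getLast?.map G.t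

/-- A cycle is a path whose initial and terminal vertices coincide. -/
def IsCycle (G : DGraph V E) (ξ : List E) : Prop :=
  G.IsPath ξ ∧ G.startO ξ = G.endO ξ

/-- A path is simple if the terminal vertices of its edges are pairwise distinct. -/
def IsSimple (G : DGraph V E) (ξ : List E) : Prop := (ξ.map G.t).Nodup

/-- A circuit is a simple cycle. -/
def IsCircuit (G : DGraph V E) (ξ : List E) : Prop := G.IsCycle ξ ∧ G.IsSimple ξ

/-- A graph is connected if any two (distinct) vertices are linked by a path. -/
def Connected (G : DGraph V E) : Prop :=
  ∀ x y : V, x ≠ y →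
    ∃ ξ : List E, G.IsPath ξ ∧ G.startO ξ = some x ∧ G.endO ξ = some y

/-- An orientation chooses exactly one edge in each pair `{e, -e}`. -/
def IsOrientation (G : DGraph V E) (Epos : Finset E) : Prop :=
  ∀ e : E, e ∈ Epos ↔ G.neg e ∉ Epos

/-- A spanning tree: a set of edges closed under reversal, joining any two
vertices, and carrying no nontrivial cycle (a cycle is trivial iff every edge
occurs in it as many times as its reversed edge). -/
def IsSpanningTree [DecidableEq E] (G : DGraph V E) (ET : Finset E) : Prop :=
  (∀ e ∈ ET, G.neg e ∈ ET) ∧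
  (∀ x y : V, x ≠ y →
    ∃ ξ : List E, G.IsPath ξ ∧ (∀ e ∈ ξ, e ∈ ET) ∧
      G.startO ξ = some x ∧ G.endO ξ = some y) ∧
  (∀ ξ : List E, G.IsCycle ξ → (∀ e ∈ ξ, e ∈ ET) →
    ∀ e : E, ξ.count e = ξ.count (G.neg e))

/-- The incidence vector of a list of edges, as an element of the vector space
`𝔠₁(Γ,ℝ)` of functions on a chosen orientation `Epos`. -/
def incidence [DecidableEq E] (G : DGraph V E) (Epos : Finset E) (ξ : List E) :
    ↥Epos → ℝ :=
  fun e => (ξ.count e.1 : ℝ) - (ξ.count (G.neg e.1) : ℝ)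

/-- The boundary map `∂ : 𝔠₁(Γ,ℝ) → 𝔠₀(Γ,ℝ)`, determined by
`∂ e = t e − o e` on the basis edges of the orientation. -/
noncomputable def boundary [Fintype E] [DecidableEq V] (G : DGraph V E)
    (Epos : Finset E) : (↥Epos → ℝ) →ₗ[ℝ] (V → ℝ) where
  toFun f := fun x => ∑ e : ↥Epos,
    f e * ((if G.t e.1 = x then (1 : ℝ) else 0) - if G.o e.1 = x then (1 : ℝ) else 0)
  map_add' f g := by
    funext x
    simp [add_mul, Finset.sum_add_distrib]
  map_smul' c f := by
    funext x
    simp [Finset.mul_sum, mul_assoc]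

/-- The maximal topological crystal over `G` determined by the map
`θ : E → ℤ^b` (coming from fundamental circuits of a spanning tree): vertices
`V × ℤ^b`, edges `E × ℤ^b`, `o (e,h) = (o e, h)` and `-(e,h) = (-e, h + θ e)`. -/
def crystal {b : ℕ} (G : DGraph V E) (θ : E → (Fin b → ℤ))
    (hθ : ∀ e, θ (G.neg e) = - θ e) :
    DGraph (V × (Fin b → ℤ)) (E × (Fin b → ℤ)) where
  o p := (G.o p.1, p.2)
  neg p := (G.neg p.1, p.2 + θ p.1)
  neg_ne p h := G.neg_ne p.1 (congrArg Prod.fst h)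
  neg_neg p := by
    have h2 : p.2 + θ p.1 + θ (G.neg p.1) = p.2 := by
      rw [hθ p.1]; abel
    exact Prod.ext (G.neg_neg p.1) h2

/-- The translation by `h₀ ∈ ℤ^b` on `X × ℤ^b`. -/
def shiftMap (X : Type) (b : ℕ) (h₀ : Fin b → ℤ) :
    X × (Fin b → ℤ) → X × (Fin b → ℤ) :=
  fun p => (p.1, p.2 + h₀)

/-- The lift of a path `ξ₀` of the base graph to the topological crystal,
starting on the sheet `h`. -/
def liftPath {b : ℕ} (θ : E → (Fin b → ℤ)) (ξ₀ : List E) (h : Fin b → ℤ) :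
    List (E × (Fin b → ℤ)) :=
  List.ofFn fun i : Fin ξ₀.length =>
    (ξ₀.get i, h + ∑ j : Fin ξ₀.length, if (j : ℕ) < (i : ℕ) then θ (ξ₀.get j) else 0)

/-- The graph metric: the minimal number of edges of a path joining two
vertices (`0` on the diagonal). -/
noncomputable def gdist [DecidableEq V] (G : DGraph V E) (u v : V) : ℕ :=
  if u = v then 0
  else sInf {n : ℕ | ∃ ξ : List E, G.IsPath ξ ∧ G.startO ξ = some u ∧
    G.endO ξ = some v ∧ ξ.length = n}

end DGraph

open DGraph

/-- An edge of a spanning tree is never a self-loop. -/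
theorem DGraph.IsSpanningTree.origin_ne_terminal {V E : Type} [DecidableEq E] {G : DGraph V E}
    {ET : Finset E} (hT : G.IsSpanningTree ET) {e : E} (he : e ∈ ET) : G.o e ≠ G.t e := by
  intro h
  have hcycle : G.IsCycle [e] :=
    ⟨⟨by simp, List.isChain_singleton e⟩, congrArg some h⟩
  have hcount := hT.2.2 [e] hcycle (by simpa using he) e
  rw [List.count_singleton_self, List.count_eq_zero_of_not_mem (by simpa using G.neg_ne e)]
    at hcount
  exact one_ne_zero hcount

/-- the maximal topological crystal over a finite connected graph
contains no self-loops (`o(e,h) ≠ t(e,h)` for every edge `(e,h)`);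
equivalently, `θ(e) ≠ 0` for every edge `e` of the base graph with
`o(e) = t(e)`. -/
theorem stmt5 {V E : Type} [Fintype V] [Fintype E] [Nonempty V]
    [DecidableEq V] [DecidableEq E]
    (G : DGraph V E) (hconn : G.Connected)
    (Epos : Finset E) (hor : G.IsOrientation Epos)
    (ET : Finset E) (hT : G.IsSpanningTree ET)
    {b : ℕ} (θ : E → (Fin b → ℤ))
    (hθneg : ∀ e, θ (G.neg e) = - θ e)
    (hθT : ∀ e ∈ ET, θ e = (0 : Fin b → ℤ))
    (ι : {e : E // e ∈ Epos ∧ e ∉ ET} ≃ Fin b)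
    (hι : ∀ e : {e : E // e ∈ Epos ∧ e ∉ ET}, θ e.1 = Pi.single (ι e) (1 : ℤ)) :
    (∀ p : E × (Fin b → ℤ),
      (DGraph.crystal G θ hθneg).o p ≠ (DGraph.crystal G θ hθneg).t p) ∧
    (∀ e : E, G.o e = G.t e → θ e ≠ 0) := by
  have hpos : ∀ e ∈ Epos, e ∉ ET → θ e ≠ 0 := fun e he heT => by
    rw [hι ⟨e, he, heT⟩]
    exact Pi.single_ne_zero_iff.mpr one_ne_zero
  have hloop : ∀ e : E, G.o e = G.t e → θ e ≠ 0 := fun e h => by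
    have heT : e ∉ ET := fun he => hT.origin_ne_terminal he h
    by_cases he : e ∈ Epos
    · exact hpos e he heT
    · have hne : G.neg e ∈ Epos := by rwa [hor, G.neg_neg]
      have hneT : G.neg e ∉ ET := fun hn => heT (by simpa [G.neg_neg] using hT.1 _ hn)
      have hθne := hpos _ hne hneT
      rwa [hθneg, neg_ne_zero] at hθne
  refine ⟨fun p hp => ?_, hloop⟩
  exact hloop p.1 (congrArg Prod.fst hp) (left_eq_add.mp (congrArg Prod.snd hp))
end

section
/- Let b ≥ 1 and let d be a metric on ℤ^b that is translation-invariant, i.e., d(h₁+k, h₂+k) = d(h₁,h₂) for all h₁,h₂,k ∈ ℤ^b, and satisfies d(0,h) ≥ |h| for all h ∈ ℤ^b, where |h| is the Euclidean norm. Then for every h ∈ ℤ^b the limit ‖h‖ := lim_{n→∞} d(0, nh)/n exists, and there is a unique norm N on ℝ^b such that N(h) = ‖h‖ for all h ∈ ℤ^b. -/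
open Filter Topology

section StableNorm

variable {ι : Type*}

theorem AddGroupSeminorm.map_zsmul_le {G : Type*} [AddCommGroup G] (p : AddGroupSeminorm G)
    (n : ℤ) (x : G) : p (n • x) ≤ |(n : ℝ)| * p x := by
  have key : ∀ k : ℕ, p (k • x) ≤ k * p x := by
    intro k
    induction k with
    | zero => simp
    | succ k ih =>
      rw [succ_nsmul]
      push_cast
      linarith [map_add_le_add p (k • x) x]
  obtain ⟨k, rfl | rfl⟩ := n.eq_nat_or_neg
  · simpa using key k
  · simpa using key k

theorem tendsto_div_of_abs_sub_le {u v : ℕ → ℝ} {B L : ℝ} (h : ∀ n, |u n - v n| ≤ B)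
    (hu : Tendsto (fun n : ℕ => u n / n) atTop (𝓝 L)) :
    Tendsto (fun n : ℕ => v n / n) atTop (𝓝 L) := by
  have hd : Tendsto (fun n : ℕ => (u n - v n) / n) atTop (𝓝 0) := by
    refine squeeze_zero_norm (fun n => ?_) (tendsto_const_div_atTop_nhds_zero_nat B)
    rw [Real.norm_eq_abs, abs_div, Nat.abs_cast]
    exact div_le_div_of_nonneg_right (h n) n.cast_nonneg
  simpa [sub_div] using hu.sub hd

/-- The coordinatewise integer part of `t • x`. -/
noncomputable def floorMul (t : ℝ) (x : ι → ℝ) : ι → ℤ := fun i => ⌊t * x i⌋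

theorem floorMul_bounds (t : ℝ) (x : ι → ℝ) (i : ι) :
    (floorMul t x i : ℝ) ≤ t * x i ∧ t * x i < floorMul t x i + 1 :=
  ⟨Int.floor_le _, Int.lt_floor_add_one _⟩

theorem tendsto_abs_floorMul_div (x : ι → ℝ) (i : ι) :
    Tendsto (fun n : ℕ => |(floorMul n x i : ℝ)| / n) atTop (𝓝 |x i|) := by
  have h : Tendsto (fun n : ℕ => |(n : ℝ) * x i| / n) atTop (𝓝 |x i|) := by
    refine tendsto_const_nhds.congr' ?_
    filter_upwards [eventually_gt_atTop 0] with n hn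
    have : (n : ℝ) ≠ 0 := by exact_mod_cast hn.ne'
    rw [abs_mul, Nat.abs_cast]
    field_simp
  refine tendsto_div_of_abs_sub_le (B := 1) (fun n => (abs_abs_sub_abs_le _ _).trans ?_) h
  have := floorMul_bounds n x i
  rw [abs_le]
  constructor <;> linarith

variable [Fintype ι] [DecidableEq ι]

/-- The sum of the values of a seminorm on the standard basis of `ℤ^ι`. -/
noncomputable def basisSum (p : AddGroupSeminorm (ι → ℤ)) : ℝ :=
  ∑ i, p (Pi.single i 1)

theorem abs_map_sub_map_le_mul_basisSum (p : AddGroupSeminorm (ι → ℤ)) {g h : ι → ℤ} {B : ℝ}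
    (hB : ∀ i, |(g i : ℝ) - h i| ≤ B) : |p g - p h| ≤ B * basisSum p := by
  refine (abs_sub_map_le_sub p g h).trans ?_
  have hsum : g - h = ∑ i, (g i - h i) • (Pi.single i 1 : ι → ℤ) := by
    ext j
    simp [Finset.sum_apply, Pi.single_apply]
  rw [hsum, basisSum, Finset.mul_sum]
  refine (Finset.le_sum_of_subadditive p (map_zero p).le (map_add_le_add p) _ _).trans ?_
  refine Finset.sum_le_sum fun i _ => (p.map_zsmul_le _ _).trans ?_
  refine mul_le_mul_of_nonneg_right ?_ (apply_nonneg p _)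
  simpa using hB i

theorem exists_tendsto_map_floorMul_div (p : AddGroupSeminorm (ι → ℤ)) (x : ι → ℝ) :
    ∃ L, Tendsto (fun n : ℕ => p (floorMul n x) / n) atTop (𝓝 L) := by
  have hC : 0 ≤ basisSum p := Finset.sum_nonneg fun i _ => apply_nonneg p _
  have hsub : Subadditive fun n : ℕ => p (floorMul n x) + basisSum p := by
    intro m n
    have h := (abs_le.1 (abs_map_sub_map_le_mul_basisSum p (B := 1)
      (g := floorMul (m + n : ℕ) x) (h := floorMul m x + floorMul n x) fun i => ?_)).2
    · linarith [map_add_le_add p (floorMul m x) (floorMul n x)]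
    · have h₁ := floorMul_bounds m x i
      have h₂ := floorMul_bounds n x i
      have h₃ := floorMul_bounds (m + n : ℕ) x i
      push_cast [add_mul] at h₃
      have hlt : floorMul (m + n : ℕ) x i < floorMul m x i + floorMul n x i + 2 := by
        have : (floorMul (m + n : ℕ) x i : ℝ) < (floorMul m x i + floorMul n x i + 2 : ℤ) := by
          push_cast
          linarith
        exact_mod_cast this
      have hlt' : floorMul m x i + floorMul n x i < floorMul (m + n : ℕ) x i + 1 := by
        have : ((floorMul m x i + floorMul n x i : ℤ) : ℝ) < (floorMul (m + n : ℕ) x i + 1 : ℤ) := by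
          push_cast
          linarith
        exact_mod_cast this
      rw [← Int.cast_sub, ← Int.cast_abs]
      have : |floorMul (m + n : ℕ) x i - (floorMul m x + floorMul n x) i| ≤ 1 := by
        rw [abs_le, Pi.add_apply]
        omega
      exact_mod_cast this
  have hbdd : BddBelow (Set.range fun n : ℕ => (p (floorMul n x) + basisSum p) / n) := by
    refine ⟨0, ?_⟩
    rintro _ ⟨n, rfl⟩
    exact div_nonneg (add_nonneg (apply_nonneg p _) hC) n.cast_nonneg
  exact ⟨hsub.lim, tendsto_div_of_abs_sub_le (B := basisSum p)
    (fun n => by simp [abs_of_nonneg hC]) (hsub.tendsto_lim hbdd)⟩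

/-- The limit of `p ⌊n x⌋ / n`. -/
noncomputable def stableLim (p : AddGroupSeminorm (ι → ℤ)) (x : ι → ℝ) : ℝ :=
  (exists_tendsto_map_floorMul_div p x).choose

theorem tendsto_stableLim (p : AddGroupSeminorm (ι → ℤ)) (x : ι → ℝ) :
    Tendsto (fun n : ℕ => p (floorMul n x) / n) atTop (𝓝 (stableLim p x)) :=
  (exists_tendsto_map_floorMul_div p x).choose_spec

theorem stableLim_add_le (p : AddGroupSeminorm (ι → ℤ)) (x y : ι → ℝ) :
    stableLim p (x + y) ≤ stableLim p x + stableLim p y := by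
  have hxy : Tendsto (fun n : ℕ => p (floorMul n x + floorMul n y) / n) atTop
      (𝓝 (stableLim p (x + y))) := by
    refine tendsto_div_of_abs_sub_le (fun n => abs_map_sub_map_le_mul_basisSum p (B := 2)
      fun i => ?_) (tendsto_stableLim p (x + y))
    have h₁ := floorMul_bounds n x i
    have h₂ := floorMul_bounds n y i
    have h₃ := floorMul_bounds n (x + y) i
    rw [Pi.add_apply, mul_add] at h₃
    rw [abs_le]
    push_cast [Pi.add_apply]
    constructor <;> linarith
  refine le_of_tendsto_of_tendsto' hxy ((tendsto_stableLim p x).add (tendsto_stableLim p y))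
    fun n => ?_
  rw [← add_div]
  exact div_le_div_of_nonneg_right (map_add_le_add p _ _) n.cast_nonneg

theorem stableLim_neg (p : AddGroupSeminorm (ι → ℤ)) (x : ι → ℝ) :
    stableLim p (-x) = stableLim p x := by
  refine tendsto_nhds_unique (tendsto_stableLim p (-x)) ?_
  have h : Tendsto (fun n : ℕ => p (-floorMul n x) / n) atTop (𝓝 (stableLim p x)) := by
    simpa using tendsto_stableLim p x
  refine tendsto_div_of_abs_sub_le (fun n => abs_map_sub_map_le_mul_basisSum p (B := 2)
    fun i => ?_) h
  have h₁ := floorMul_bounds n x i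
  have h₂ := floorMul_bounds n (-x) i
  rw [Pi.neg_apply, mul_neg] at h₂
  rw [abs_le]
  push_cast [Pi.neg_apply]
  constructor <;> linarith

theorem stableLim_zero (p : AddGroupSeminorm (ι → ℤ)) : stableLim p 0 = 0 := by
  refine tendsto_nhds_unique (tendsto_stableLim p 0) ?_
  have h (n : ℕ) : floorMul n (0 : ι → ℝ) = 0 := by
    ext i
    simp [floorMul]
  simp [h]

theorem stableLim_smul_of_pos (p : AddGroupSeminorm (ι → ℤ)) {c : ℝ} (hc : 0 < c) (x : ι → ℝ) :
    stableLim p (c • x) = c * stableLim p x := by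
  refine tendsto_nhds_unique (tendsto_stableLim p (c • x)) ?_
  have hcn : Tendsto (fun n : ℕ => c * (n : ℝ)) atTop atTop :=
    tendsto_natCast_atTop_atTop.const_mul_atTop hc
  have hm : Tendsto (fun n : ℕ => ⌊c * (n : ℝ)⌋₊) atTop atTop := tendsto_nat_floor_atTop.comp hcn
  have hq : Tendsto (fun n : ℕ => (⌊c * (n : ℝ)⌋₊ : ℝ) / n) atTop (𝓝 c) :=
    (tendsto_nat_floor_mul_div_atTop hc.le).comp tendsto_natCast_atTop_atTop
  have h : Tendsto (fun n : ℕ => p (floorMul ⌊c * (n : ℝ)⌋₊ x) / n) atTop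
      (𝓝 (c * stableLim p x)) := by
    refine (hq.mul ((tendsto_stableLim p x).comp hm)).congr' ?_
    filter_upwards [hm.eventually_gt_atTop 0] with n hn
    have : (⌊c * (n : ℝ)⌋₊ : ℝ) ≠ 0 := by exact_mod_cast hn.ne'
    simp only [Function.comp_apply]
    field_simp
  refine tendsto_div_of_abs_sub_le (fun n => abs_map_sub_map_le_mul_basisSum p
    (B := (∑ i, |x i|) + 1) fun i => ?_) h
  have h₁ := floorMul_bounds ⌊c * (n : ℝ)⌋₊ x i
  have h₂ := floorMul_bounds n (c • x) i
  rw [Pi.smul_apply, smul_eq_mul, ← mul_assoc, mul_comm (n : ℝ) c] at h₂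
  have h₃ : |(c * n - ⌊c * (n : ℝ)⌋₊) * x i| ≤ |x i| := by
    rw [abs_mul]
    refine mul_le_of_le_one_left (abs_nonneg _) (abs_le.2 ?_)
    have := Nat.floor_le (mul_nonneg hc.le n.cast_nonneg : 0 ≤ c * (n : ℝ))
    have := Nat.lt_floor_add_one (c * (n : ℝ))
    constructor <;> linarith
  have h₄ : |x i| ≤ ∑ i, |x i| :=
    Finset.single_le_sum (f := fun i => |x i|) (fun _ _ => abs_nonneg _) (Finset.mem_univ i)
  rw [sub_mul, abs_le] at h₃
  rw [abs_le]
  constructor <;> linarith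

theorem stableLim_smul (p : AddGroupSeminorm (ι → ℤ)) (c : ℝ) (x : ι → ℝ) :
    stableLim p (c • x) = |c| * stableLim p x := by
  rcases lt_trichotomy c 0 with hc | rfl | hc
  · rw [← stableLim_neg, ← neg_smul, stableLim_smul_of_pos p (neg_pos.2 hc), abs_of_neg hc]
  · simp [stableLim_zero]
  · rw [stableLim_smul_of_pos p hc, abs_of_pos hc]

theorem tendsto_map_zsmul_div (p : AddGroupSeminorm (ι → ℤ)) (h : ι → ℤ) :
    Tendsto (fun n : ℕ => p ((n : ℤ) • h) / n) atTop (𝓝 (stableLim p fun i => (h i : ℝ))) := by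
  refine (tendsto_stableLim p fun i => (h i : ℝ)).congr fun n => ?_
  congr 2
  ext i
  have : (n : ℝ) * (h i : ℝ) = ((n * h i : ℤ) : ℝ) := by push_cast; rfl
  simp only [floorMul, this, Int.floor_intCast, Pi.smul_apply, smul_eq_mul]

theorem tendsto_seminorm_floorMul_div (N : Seminorm ℝ (ι → ℝ)) (x : ι → ℝ) :
    Tendsto (fun n : ℕ => N (fun i => (floorMul n x i : ℝ)) / n) atTop (𝓝 (N x)) := by
  have h : Tendsto (fun n : ℕ => N ((n : ℝ) • x) / n) atTop (𝓝 (N x)) := by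
    refine tendsto_const_nhds.congr' ?_
    filter_upwards [eventually_gt_atTop 0] with n hn
    have : (n : ℝ) ≠ 0 := by exact_mod_cast hn.ne'
    rw [map_smul_eq_mul, Real.norm_natCast]
    field_simp
  refine tendsto_div_of_abs_sub_le (B := ∑ i, N (Pi.single i 1))
    (fun n => (abs_sub_map_le_sub N _ _).trans ?_) h
  have hsum : ((n : ℝ) • x - fun i => (floorMul n x i : ℝ)) =
      ∑ i, (n * x i - floorMul n x i) • (Pi.single i 1 : ι → ℝ) := by
    ext j
    simp [Finset.sum_apply, Pi.single_apply]
  rw [hsum]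
  refine (Finset.le_sum_of_subadditive N (map_zero N).le (map_add_le_add N) _ _).trans ?_
  refine Finset.sum_le_sum fun i _ => ?_
  rw [map_smul_eq_mul]
  refine mul_le_of_le_one_left (apply_nonneg N _) ?_
  have := floorMul_bounds n x i
  rw [Real.norm_eq_abs, abs_le]
  constructor <;> linarith

/-- A seminorm on `ℝ^ι` is determined by its values on `ℤ^ι`. -/
theorem seminorm_eq_of_eq_on_int {M N : Seminorm ℝ (ι → ℝ)}
    (h : ∀ k : ι → ℤ, M (fun i => (k i : ℝ)) = N fun i => (k i : ℝ)) : M = N := by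
  ext x
  refine tendsto_nhds_unique (tendsto_seminorm_floorMul_div M x) ?_
  simpa only [h] using tendsto_seminorm_floorMul_div N x

end StableNorm

/-- a translation-invariant metric `d` on `ℤ^b` with
`d(0,h) ≥ |h|` admits a stable norm: the limit `‖h‖ = lim d(0,nh)/n` exists for
every `h ∈ ℤ^b`, and there is a unique norm `N` on `ℝ^b` with `N(h) = ‖h‖` for
all `h ∈ ℤ^b`. -/
theorem stmt11 (b : ℕ) (hb : 1 ≤ b)
    (d : (Fin b → ℤ) → (Fin b → ℤ) → ℝ)
    (hsymm : ∀ h₁ h₂, d h₁ h₂ = d h₂ h₁)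
    (heq : ∀ h₁ h₂, d h₁ h₂ = 0 ↔ h₁ = h₂)
    (htri : ∀ h₁ h₂ h₃, d h₁ h₃ ≤ d h₁ h₂ + d h₂ h₃)
    (hinv : ∀ h₁ h₂ k, d (h₁ + k) (h₂ + k) = d h₁ h₂)
    (hlb : ∀ h, Real.sqrt (∑ i : Fin b, ((h i : ℝ)) ^ 2) ≤ d 0 h) :
    ∃ nn : (Fin b → ℤ) → ℝ,
      (∀ h, Filter.Tendsto (fun n : ℕ => d 0 ((n : ℤ) • h) / (n : ℝ))
        Filter.atTop (nhds (nn h))) ∧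
      ∃! N : (Fin b → ℝ) → ℝ,
        ((∀ x, N x = 0 ↔ x = 0) ∧
         (∀ (c : ℝ) (x : Fin b → ℝ), N (c • x) = |c| * N x) ∧
         (∀ x y, N (x + y) ≤ N x + N y)) ∧
        (∀ h : Fin b → ℤ, N (fun i => (h i : ℝ)) = nn h) := by
  have hzero : d 0 0 = 0 := (heq 0 0).2 rfl
  have hadd (g h : Fin b → ℤ) : d 0 (g + h) ≤ d 0 g + d 0 h := by
    have h₁ := htri 0 h (g + h)
    have h₂ := hinv 0 g h
    rw [zero_add] at h₂
    linarith
  have hneg (h : Fin b → ℤ) : d 0 (-h) = d 0 h := by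
    have h₁ := hinv 0 (-h) h
    rw [zero_add, neg_add_cancel, hsymm] at h₁
    exact h₁.symm
  let p : AddGroupSeminorm (Fin b → ℤ) :=
    { toFun := d 0, map_zero' := hzero, add_le' := hadd, neg' := hneg }
  refine ⟨fun h => stableLim p fun i => (h i : ℝ), tendsto_map_zsmul_div p, stableLim p,
    ⟨⟨fun x => ⟨fun hx => ?_, ?_⟩, stableLim_smul p, stableLim_add_le p⟩, fun _ => rfl⟩, ?_⟩
  · ext i
    refine abs_nonpos_iff.1 (hx ▸ le_of_tendsto_of_tendsto' (tendsto_abs_floorMul_div x i)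
      (tendsto_stableLim p x) fun n => ?_)
    refine div_le_div_of_nonneg_right (le_trans ?_ (hlb (floorMul n x))) n.cast_nonneg
    refine Real.abs_le_sqrt ?_
    exact Finset.single_le_sum (f := fun i => (floorMul n x i : ℝ) ^ 2)
      (fun _ _ => sq_nonneg _) (Finset.mem_univ i)
  · rintro rfl
    exact stableLim_zero p
  · rintro N ⟨⟨-, hsmul, hle⟩, hN⟩
    exact congrArg DFunLike.coe (seminorm_eq_of_eq_on_int (M := Seminorm.of N hle hsmul)
      (N := Seminorm.of (stableLim p) (stableLim_add_le p) (stableLim_smul p)) hN)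
end

section
/- The map σ : [a₀,∞) → ℝ is continuous and strictly increasing. In addition, it is strictly concave and continuously differentiable on (a₀,∞), and σ(a)/a → 0 as a → +∞. -/
/-- The critical value `a₀ := max_{s∈[0,1]} min_{ρ∈ℝ} H(s,ρ)`. -/
noncomputable def a0 (H : ℝ → ℝ → ℝ) : ℝ :=
  sSup ((fun s => sInf (Set.range (H s))) '' Set.Icc (0 : ℝ) 1)

/-- `σ⁺_a(s) := max {ρ | H(s,ρ) = a}`. -/
noncomputable def sigmaPlus (H : ℝ → ℝ → ℝ) (a s : ℝ) : ℝ :=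
  sSup {ρ : ℝ | H s ρ = a}

/-- `σ(a) := ∫₀¹ σ⁺_a(s) ds`. -/
noncomputable def sigmaFn (H : ℝ → ℝ → ℝ) (a : ℝ) : ℝ :=
  ∫ s in (0 : ℝ)..1, sigmaPlus H a s

open Set Filter Topology MeasureTheory

section SublevelSets

variable {f : ℝ → ℝ} {a : ℝ}

/-- A function of superlinear growth is coercive. -/
theorem tendsto_cocompact_atTop_of_superlinear
    (hsup : ∀ C : ℝ, ∃ R : ℝ, ∀ ρ : ℝ, R ≤ |ρ| → C ≤ f ρ / |ρ|) :
    Tendsto f (cocompact ℝ) atTop := by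
  refine tendsto_atTop.2 fun b => ?_
  obtain ⟨R, hR⟩ := hsup |b|
  filter_upwards [(tendsto_norm_cocompact_atTop (E := ℝ)).eventually_ge_atTop (max R 1)]
    with ρ hρ
  rw [Real.norm_eq_abs] at hρ
  have h1 : 1 ≤ |ρ| := (le_max_right _ _).trans hρ
  have h2 := hR ρ ((le_max_left _ _).trans hρ)
  rw [le_div_iff₀ (by linarith)] at h2
  nlinarith [le_abs_self b, abs_nonneg b]

/-- The largest point of a nonempty sublevel set of a coercive function lies on the level. -/
theorem exists_level_isGreatest_sublevel (hf : Continuous f)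
    (hlim : Tendsto f (cocompact ℝ) atTop) (ha : ∃ ρ, f ρ ≤ a) :
    ∃ g, f g = a ∧ ∀ ρ, f ρ ≤ a → ρ ≤ g := by
  obtain ⟨K, hK, hKa⟩ := mem_cocompact.1 (hlim.eventually_gt_atTop a)
  have hc : IsCompact {ρ | f ρ ≤ a} := by
    refine hK.of_isClosed_subset (isClosed_le hf continuous_const) fun ρ hρ => ?_
    by_contra hn
    exact not_lt.2 (show f ρ ≤ a from hρ) (hKa hn)
  obtain ⟨g, hg, hmax⟩ := hc.exists_isGreatest ha
  refine ⟨g, le_antisymm hg ?_, fun ρ hρ => hmax hρ⟩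
  by_contra! hlt
  obtain ⟨ρ, hρa, hgρ⟩ := (((hf.tendsto g).eventually_lt_const hlt).filter_mono
    nhdsWithin_le_nhds |>.and (self_mem_nhdsWithin : Ioi g ∈ 𝓝[>] g)).exists
  exact absurd (hmax (show f ρ ≤ a from hρa.le)) (not_le.2 hgρ)

end SublevelSets

section Parametric

variable {X : Type*} [TopologicalSpace X] {S : Set X} {H : X → ℝ → ℝ}

/-- The partial map at a fixed second variable is continuous. -/
theorem continuousOn_fixed_right (hH : ContinuousOn (fun p : X × ℝ => H p.1 p.2) (S ×ˢ univ))
    (ρ : ℝ) : ContinuousOn (fun s => H s ρ) S :=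
  hH.comp (f := fun s => (s, ρ)) (by fun_prop) fun _ hs => ⟨hs, mem_univ _⟩

/-- The derivative of a differentiable convex function depends continuously on parameters. -/
theorem continuousOn_deriv_of_convexOn
    (hH : ContinuousOn (fun p : X × ℝ => H p.1 p.2) (S ×ˢ univ))
    (hdiff : ∀ s ∈ S, Differentiable ℝ (H s)) (hconv : ∀ s ∈ S, ConvexOn ℝ univ (H s)) :
    ContinuousOn (fun p : X × ℝ => deriv (H p.1) p.2) (S ×ˢ univ) := by
  have hq : ∀ h : ℝ, ContinuousOn (fun p : X × ℝ => (H p.1 (p.2 + h) - H p.1 p.2) / h)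
      (S ×ˢ univ) := fun h =>
    ((hH.comp (f := fun p : X × ℝ => (p.1, p.2 + h)) (by fun_prop)
      fun p hp => ⟨hp.1, mem_univ _⟩).sub hH).div_const h
  rintro ⟨s, ρ⟩ ⟨hs, -⟩
  have hslope := (hdiff s hs ρ).hasDerivAt.tendsto_slope_zero
  refine tendsto_order.2 ⟨fun c hc => ?_, fun c hc => ?_⟩
  · obtain ⟨h, hlt, hneg⟩ := ((hslope.mono_left (nhdsLT_le_nhdsNE 0)).eventually_const_lt hc
      |>.and (self_mem_nhdsWithin : Iio (0 : ℝ) ∈ 𝓝[<] 0)).exists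
    rw [smul_eq_mul, inv_mul_eq_div] at hlt
    filter_upwards [(hq h (s, ρ) ⟨hs, mem_univ _⟩).eventually_const_lt hlt,
      self_mem_nhdsWithin] with p hp hpS
    refine hp.trans_le ?_
    have := (hconv p.1 hpS.1).slope_le_deriv (mem_univ (p.2 + h)) (mem_univ p.2)
      (by simpa using hneg) (hdiff p.1 hpS.1 p.2)
    rw [slope_comm, slope_def_field] at this
    simpa using this
  · obtain ⟨h, hlt, hpos⟩ := ((hslope.mono_left (nhdsGT_le_nhdsNE 0)).eventually_lt_const hc
      |>.and (self_mem_nhdsWithin : Ioi (0 : ℝ) ∈ 𝓝[>] 0)).exists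
    rw [smul_eq_mul, inv_mul_eq_div] at hlt
    filter_upwards [(hq h (s, ρ) ⟨hs, mem_univ _⟩).eventually_lt_const hlt,
      self_mem_nhdsWithin] with p hp hpS
    refine lt_of_le_of_lt ?_ hp
    have := (hconv p.1 hpS.1).deriv_le_slope (mem_univ p.2) (mem_univ (p.2 + h))
      (by simpa using hpos) (hdiff p.1 hpS.1 p.2)
    rw [slope_def_field] at this
    simpa using this

/-- The right end of the sublevel sets of strictly convex functions is jointly continuous in the
level and in the parameter. -/
theorem continuousOn_level_of_strictConvexOn {P : ℝ → X → ℝ} {A : Set ℝ}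
    (hH : ContinuousOn (fun p : X × ℝ => H p.1 p.2) (S ×ˢ univ))
    (hconv : ∀ s ∈ S, StrictConvexOn ℝ univ (H s))
    (hP : ∀ a ∈ A, ∀ s ∈ S, H s (P a s) = a)
    (hmax : ∀ a ∈ A, ∀ s ∈ S, ∀ ρ, H s ρ ≤ a → ρ ≤ P a s) :
    ContinuousOn (fun p : ℝ × X => P p.1 p.2) (A ×ˢ S) := by
  rintro ⟨a, s⟩ ⟨ha, hs⟩
  have hcH : ∀ ρ, Tendsto (fun p : ℝ × X => H p.2 ρ) (𝓝[A ×ˢ S] (a, s)) (𝓝 (H s ρ)) :=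
    fun ρ => ((continuousOn_fixed_right hH ρ).comp (f := Prod.snd (α := ℝ)) (by fun_prop)
      fun p hp => hp.2) (a, s) ⟨ha, hs⟩
  have hca : Tendsto (fun p : ℝ × X => p.1) (𝓝[A ×ˢ S] (a, s)) (𝓝 a) :=
    (continuous_fst.tendsto (a, s)).mono_left nhdsWithin_le_nhds
  have hbelow : ∀ ρ, H s ρ < a → ∀ᶠ p in 𝓝[A ×ˢ S] (a, s), ρ < P p.1 p.2 := fun ρ hρ => by
    filter_upwards [(hcH ρ).eventually_lt hca hρ, self_mem_nhdsWithin] with p hp hpS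
    refine lt_of_le_of_ne (hmax _ hpS.1 _ hpS.2 _ hp.le) fun he => ?_
    rw [he, hP _ hpS.1 _ hpS.2] at hp
    exact lt_irrefl _ hp
  refine tendsto_order.2 ⟨fun ρ (hρ : ρ < P a s) => ?_, fun ρ (hρ : P a s < ρ) => ?_⟩
  · rcases lt_trichotomy (H s ρ) a with h | h | h
    · exact hbelow ρ h
    · have hmid : H s ((1 / 2 : ℝ) • ρ + (1 / 2 : ℝ) • P a s) < a := by
        have := (hconv s hs).2 (mem_univ ρ) (mem_univ (P a s)) hρ.ne
          (by norm_num : (0 : ℝ) < 1 / 2) (by norm_num : (0 : ℝ) < 1 / 2) (by norm_num)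
        rw [h, hP a ha s hs] at this
        simp only [smul_eq_mul] at this ⊢
        linarith
      filter_upwards [hbelow _ hmid] with p hp
      simp only [smul_eq_mul] at hp
      linarith
    · rw [← hP a ha s hs] at h
      filter_upwards [(hcH (P a s)).eventually_lt (hcH ρ) h, self_mem_nhdsWithin] with p hp hpS
      by_contra! hle
      have h1 : p.1 < H p.2 (P a s) := by
        by_contra! hn
        linarith [hmax _ hpS.1 _ hpS.2 _ hn]
      rw [← hP _ hpS.1 _ hpS.2] at h1
      have := (hconv p.2 hpS.2).convexOn.le_max_of_mem_Icc (mem_univ (P p.1 p.2))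
        (mem_univ (P a s)) ⟨hle, hρ.le⟩
      rw [max_eq_right h1.le] at this
      linarith
  · obtain ⟨r, hr, hrρ⟩ := exists_between hρ
    have h1 : a < H s r := by
      by_contra! hn
      linarith [hmax a ha s hs r hn]
    have h2 : H s (P a s) < H s r := by rwa [hP a ha s hs]
    filter_upwards [(hcH (P a s)).eventually_lt (hcH r) h2, hca.eventually_lt (hcH r) h1,
      self_mem_nhdsWithin] with p hp hp' hpS
    refine lt_of_not_ge fun hge => ?_
    have := (hconv p.2 hpS.2).convexOn.le_right_of_left_le'' (mem_univ (P a s))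
      (mem_univ (P p.1 p.2)) hr (hrρ.le.trans hge) hp.le
    rw [hP _ hpS.1 _ hpS.2] at this
    linarith

end Parametric

section IntervalIntegral

variable {F F' : ℝ → ℝ → ℝ} {A : Set ℝ}

/-- Integration over `[0,1]` preserves continuity on a product set. -/
theorem continuousOn_integral_unitInterval
    (hF : ContinuousOn (fun p : ℝ × ℝ => F p.1 p.2) (A ×ˢ Icc 0 1)) :
    ContinuousOn (fun a => ∫ s in (0 : ℝ)..1, F a s) A := by
  rw [continuousOn_iff_continuous_domRestrict]
  have hG : Continuous (Function.uncurry fun (a : A) (s : ℝ) =>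
      F a (projIcc (0 : ℝ) 1 zero_le_one s)) :=
    hF.comp_continuous
      (f := fun p : A × ℝ => ((p.1 : ℝ), (projIcc (0 : ℝ) 1 zero_le_one p.2 : ℝ)))
      (by fun_prop) fun p => ⟨p.1.2, (projIcc (0 : ℝ) 1 zero_le_one p.2).2⟩
  refine (intervalIntegral.continuous_parametric_intervalIntegral_of_continuous'
    (μ := volume) hG 0 1).congr fun a => ?_
  refine intervalIntegral.integral_congr fun s hs => ?_
  rw [uIcc_of_le zero_le_one] at hs
  simp only [projIcc_of_mem zero_le_one hs]

/-- Differentiation under the integral sign over `[0,1]` for a jointly continuous derivative. -/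
theorem hasDerivAt_integral_unitInterval (hA : IsOpen A)
    (hF : ∀ a ∈ A, ContinuousOn (F a) (Icc 0 1))
    (hF' : ContinuousOn (fun p : ℝ × ℝ => F' p.1 p.2) (A ×ˢ Icc 0 1))
    (hderiv : ∀ a ∈ A, ∀ s ∈ Icc (0 : ℝ) 1, HasDerivAt (fun x => F x s) (F' a s) a)
    {a : ℝ} (ha : a ∈ A) :
    HasDerivAt (fun x => ∫ s in (0 : ℝ)..1, F x s) (∫ s in (0 : ℝ)..1, F' a s) a := by
  obtain ⟨K, hK, haK, hKA⟩ := exists_compact_subset hA ha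
  obtain ⟨C, hC⟩ := (hK.prod isCompact_Icc).exists_bound_of_continuousOn
    (hF'.mono (prod_mono_left hKA))
  have hsub : uIoc (0 : ℝ) 1 ⊆ Icc 0 1 := by
    rw [uIoc_of_le zero_le_one]
    exact Ioc_subset_Icc_self
  have hF'a : ContinuousOn (F' a) (Icc 0 1) :=
    hF'.comp (f := fun s : ℝ => (a, s)) (by fun_prop) fun s hs => ⟨ha, hs⟩
  refine (intervalIntegral.hasDerivAt_integral_of_dominated_loc_of_deriv_le
    (bound := fun _ => C) (mem_interior_iff_mem_nhds.1 haK) ?_ ?_ ?_ ?_ ?_ ?_).2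
  · filter_upwards [hA.mem_nhds ha] with x hx
    exact ((hF x hx).mono hsub).aestronglyMeasurable measurableSet_uIoc
  · exact (hF a ha).intervalIntegrable_of_Icc zero_le_one
  · exact (hF'a.mono hsub).aestronglyMeasurable measurableSet_uIoc
  · exact Eventually.of_forall fun s hs x hx => hC (x, s) ⟨hx, hsub hs⟩
  · exact intervalIntegrable_const
  · exact Eventually.of_forall fun s hs x hx => hderiv x (hKA hx) s (hsub hs)

end IntervalIntegral

/-- Every minimum of `H(s,·)` is at most `a₀`. -/
theorem exists_le_a0 {H : ℝ → ℝ → ℝ}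
    (hH : ContinuousOn (fun p : ℝ × ℝ => H p.1 p.2) (Icc (0 : ℝ) 1 ×ˢ univ))
    (hcont : ∀ s ∈ Icc (0 : ℝ) 1, Continuous (H s))
    (hlim : ∀ s ∈ Icc (0 : ℝ) 1, Tendsto (H s) (cocompact ℝ) atTop)
    {s : ℝ} (hs : s ∈ Icc (0 : ℝ) 1) : ∃ ρ, H s ρ ≤ a0 H := by
  have hmin : ∀ t ∈ Icc (0 : ℝ) 1, ∃ m, sInf (range (H t)) = H t m ∧ ∀ ρ, H t m ≤ H t ρ :=
    fun t ht => by
    obtain ⟨m, hm⟩ := (hcont t ht).exists_forall_le (hlim t ht)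
    exact ⟨m, IsLeast.csInf_eq ⟨mem_range_self m, forall_mem_range.2 hm⟩, hm⟩
  obtain ⟨B, hB⟩ := isCompact_Icc.bddAbove_image (continuousOn_fixed_right hH 0)
  obtain ⟨m, hm, -⟩ := hmin s hs
  refine ⟨m, hm ▸ le_csSup ⟨B, ?_⟩ (mem_image_of_mem _ hs)⟩
  rintro _ ⟨t, ht, rfl⟩
  obtain ⟨k, hk, hk'⟩ := hmin t ht
  exact hk.trans_le ((hk' 0).trans (hB (mem_image_of_mem _ ht)))

/-- the map `σ : [a₀,∞) → ℝ` is continuous and strictly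
increasing; moreover it is strictly concave and continuously differentiable on
`(a₀,∞)`, and `σ(a)/a → 0` as `a → +∞`. -/
theorem stmt12 (H : ℝ → ℝ → ℝ)
    (hHcont : ContinuousOn (fun p : ℝ × ℝ => H p.1 p.2)
      (Set.Icc (0 : ℝ) 1 ×ˢ (Set.univ : Set ℝ)))
    (hHdiff : ∀ s ∈ Set.Icc (0 : ℝ) 1, ContDiff ℝ 1 (H s))
    (hHconv : ∀ s ∈ Set.Icc (0 : ℝ) 1, StrictConvexOn ℝ (Set.univ : Set ℝ) (H s))
    (hHsup : ∀ C : ℝ, ∃ R : ℝ, ∀ s ∈ Set.Icc (0 : ℝ) 1, ∀ ρ : ℝ,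
      R ≤ |ρ| → C ≤ H s ρ / |ρ|) :
    ContinuousOn (sigmaFn H) (Set.Ici (a0 H)) ∧
    StrictMonoOn (sigmaFn H) (Set.Ici (a0 H)) ∧
    StrictConcaveOn ℝ (Set.Ioi (a0 H)) (sigmaFn H) ∧
    (∀ a ∈ Set.Ioi (a0 H), DifferentiableAt ℝ (sigmaFn H) a) ∧
    ContinuousOn (deriv (sigmaFn H)) (Set.Ioi (a0 H)) ∧
    Filter.Tendsto (fun a => sigmaFn H a / a) Filter.atTop (nhds 0) := by
  have hcont : ∀ s ∈ Icc (0 : ℝ) 1, Continuous (H s) := fun s hs => (hHdiff s hs).continuous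
  have hdiff : ∀ s ∈ Icc (0 : ℝ) 1, Differentiable ℝ (H s) := fun s hs =>
    (hHdiff s hs).differentiable one_ne_zero
  have hlim : ∀ s ∈ Icc (0 : ℝ) 1, Tendsto (H s) (cocompact ℝ) atTop := fun s hs =>
    tendsto_cocompact_atTop_of_superlinear fun C => (hHsup C).imp fun R hR => hR s hs
  have hlevel : ∀ a ∈ Ici (a0 H), ∀ s ∈ Icc (0 : ℝ) 1, H s (sigmaPlus H a s) = a ∧
      ∀ ρ, H s ρ ≤ a → ρ ≤ sigmaPlus H a s := fun a ha s hs => by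
    obtain ⟨ρ, hρ⟩ := exists_le_a0 hHcont hcont hlim hs
    obtain ⟨g, hg, hgm⟩ :=
      exists_level_isGreatest_sublevel (hcont s hs) (hlim s hs) ⟨ρ, hρ.trans ha⟩
    have : sigmaPlus H a s = g :=
      IsGreatest.csSup_eq ⟨hg, fun r (hr : H s r = a) => hgm r hr.le⟩
    exact this ▸ ⟨hg, hgm⟩
  have hP := fun a ha s hs => (hlevel a ha s hs).1
  have hmax := fun a ha s hs => (hlevel a ha s hs).2
  have hlt : ∀ a ∈ Ici (a0 H), ∀ s ∈ Icc (0 : ℝ) 1, ∀ ρ, H s ρ < a → ρ < sigmaPlus H a s :=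
    fun a ha s hs ρ hρ => by
    refine lt_of_le_of_ne (hmax a ha s hs ρ hρ.le) fun he => ?_
    rw [he, hP a ha s hs] at hρ
    exact lt_irrefl _ hρ
  have hPc : ContinuousOn (fun p : ℝ × ℝ => sigmaPlus H p.1 p.2) (Ici (a0 H) ×ˢ Icc 0 1) :=
    continuousOn_level_of_strictConvexOn hHcont hHconv hP hmax
  have hPs : ∀ a ∈ Ici (a0 H), ContinuousOn (sigmaPlus H a) (Icc 0 1) := fun a ha =>
    hPc.comp (f := fun s : ℝ => (a, s)) (by fun_prop) fun s hs => ⟨ha, hs⟩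
  have hmono : StrictMonoOn (sigmaFn H) (Ici (a0 H)) := fun a ha b hb hab => by
    have h : ∀ s ∈ Icc (0 : ℝ) 1, sigmaPlus H a s < sigmaPlus H b s := fun s hs =>
      hlt b hb s hs _ (by rwa [hP a ha s hs])
    exact intervalIntegral.integral_lt_integral_of_continuousOn_of_le_of_exists_lt zero_lt_one
      (hPs a ha) (hPs b hb) (fun s hs => (h s (Ioc_subset_Icc_self hs)).le)
      ⟨0, by simp, h 0 (by simp)⟩
  have hpos : ∀ a ∈ Ioi (a0 H), ∀ s ∈ Icc (0 : ℝ) 1, 0 < deriv (H s) (sigmaPlus H a s) :=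
    fun a ha s hs => by
    obtain ⟨ρ, hρ⟩ := exists_le_a0 hHcont hcont hlim hs
    have hρa : H s ρ < a := hρ.trans_lt ha
    have hρP := hlt a (Ioi_subset_Ici_self ha) s hs ρ hρa
    refine lt_of_lt_of_le ?_ ((hHconv s hs).convexOn.slope_le_deriv (mem_univ ρ) (mem_univ _)
      hρP (hdiff s hs _))
    rw [slope_def_field, hP a (Ioi_subset_Ici_self ha) s hs]
    exact div_pos (sub_pos.2 hρa) (sub_pos.2 hρP)
  have hPderiv : ∀ a ∈ Ioi (a0 H), ∀ s ∈ Icc (0 : ℝ) 1, HasDerivAt (fun x => sigmaPlus H x s)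
      (deriv (H s) (sigmaPlus H a s))⁻¹ a := fun a ha s hs => by
    refine HasDerivAt.of_local_left_inverse ?_ (hdiff s hs _).hasDerivAt (hpos a ha s hs).ne' ?_
    · exact ((hPc.comp (f := fun x : ℝ => (x, s)) (by fun_prop) fun x hx => ⟨hx, hs⟩) :
        ContinuousOn (fun x => sigmaPlus H x s) (Ici (a0 H))).continuousAt (Ici_mem_nhds ha)
    · filter_upwards [Ici_mem_nhds ha] with x hx using hP x hx s hs
  have hDc : ContinuousOn (fun p : ℝ × ℝ => (deriv (H p.2) (sigmaPlus H p.1 p.2))⁻¹)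
      (Ioi (a0 H) ×ˢ Icc 0 1) := by
    refine ContinuousOn.inv₀ ?_ fun p hp => (hpos p.1 hp.1 p.2 hp.2).ne'
    exact (continuousOn_deriv_of_convexOn hHcont hdiff fun s hs => (hHconv s hs).convexOn).comp
      (f := fun p : ℝ × ℝ => (p.2, sigmaPlus H p.1 p.2))
      (continuousOn_snd.prodMk (hPc.mono (prod_mono_left Ioi_subset_Ici_self)))
      fun p hp => ⟨hp.2, mem_univ _⟩
  have hderiv : ∀ a ∈ Ioi (a0 H), HasDerivAt (sigmaFn H)
      (∫ s in (0 : ℝ)..1, (deriv (H s) (sigmaPlus H a s))⁻¹) a := fun a ha =>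
    hasDerivAt_integral_unitInterval (F' := fun a s => (deriv (H s) (sigmaPlus H a s))⁻¹)
      isOpen_Ioi (fun x hx => hPs x (Ioi_subset_Ici_self hx)) hDc hPderiv ha
  refine ⟨continuousOn_integral_unitInterval hPc, hmono, ⟨convex_Ioi _, ?_⟩,
    fun a ha => (hderiv a ha).differentiableAt, ?_, ?_⟩
  · intro a ha b hb hab t u ht hu htu
    have hc := convex_Ioi (𝕜 := ℝ) (a0 H) ha hb ht.le hu.le htu
    replace hc := Ioi_subset_Ici_self hc
    replace ha := Ioi_subset_Ici_self ha
    replace hb := Ioi_subset_Ici_self hb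
    have h : ∀ s ∈ Icc (0 : ℝ) 1, t * sigmaPlus H a s + u * sigmaPlus H b s <
        sigmaPlus H (t • a + u • b) s := fun s hs => by
      refine hlt _ hc s hs _ ?_
      have hne : sigmaPlus H a s ≠ sigmaPlus H b s := fun he =>
        hab (by rw [← hP a ha s hs, he, hP b hb s hs])
      have := (hHconv s hs).2 (mem_univ _) (mem_univ _) hne ht hu htu
      rwa [hP a ha s hs, hP b hb s hs] at this
    have hta := (hPs a ha).const_mul t
    have hub := (hPs b hb).const_mul u
    have hlast := intervalIntegral.integral_lt_integral_of_continuousOn_of_le_of_exists_lt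
      zero_lt_one (hta.add hub) (hPs _ hc) (fun s hs => (h s (Ioc_subset_Icc_self hs)).le)
      ⟨0, by simp, h 0 (by simp)⟩
    simp only [Pi.add_apply] at hlast
    rw [intervalIntegral.integral_add (hta.intervalIntegrable_of_Icc zero_le_one)
      (hub.intervalIntegrable_of_Icc zero_le_one), intervalIntegral.integral_const_mul,
      intervalIntegral.integral_const_mul] at hlast
    exact hlast
  · exact (continuousOn_integral_unitInterval
      (F := fun a s => (deriv (H s) (sigmaPlus H a s))⁻¹) hDc).congr fun a ha => (hderiv a ha).deriv
  · refine tendsto_order.2 ⟨fun c hc => ?_, fun c hc => ?_⟩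
    · filter_upwards [(tendsto_id.const_div_atTop (sigmaFn H (a0 H))).eventually_const_lt hc,
        eventually_ge_atTop (a0 H), eventually_gt_atTop 0] with a h1 h2 h3
      refine h1.trans_le (div_le_div_of_nonneg_right ?_ h3.le)
      exact hmono.monotoneOn self_mem_Ici h2 h2
    · obtain ⟨R, hR⟩ := hHsup (2 / c)
      filter_upwards [eventually_ge_atTop (a0 H), eventually_gt_atTop 0,
        eventually_ge_atTop (2 * R / c)] with a ha ha0 haR
      have hbound : ∀ s ∈ Icc (0 : ℝ) 1, sigmaPlus H a s ≤ a * c / 2 := fun s hs => by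
        by_contra! hn
        have hp : 0 < sigmaPlus H a s := lt_trans (by positivity) hn
        have hRp : R ≤ |sigmaPlus H a s| := by
          rw [abs_of_pos hp]
          rw [div_le_iff₀ hc] at haR
          linarith
        have := hR s hs _ hRp
        rw [abs_of_pos hp, hP a ha s hs, div_le_div_iff₀ hc hp] at this
        linarith
      have hint := intervalIntegral.integral_mono_on (zero_le_one (α := ℝ))
        ((hPs a ha).intervalIntegrable_of_Icc zero_le_one)
        (intervalIntegrable_const (μ := volume)) hbound
      rw [intervalIntegral.integral_const, sub_zero, one_smul] at hint
      rw [div_lt_iff₀ ha0]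
      have : 0 < c * a := mul_pos hc ha0
      change sigmaFn H a ≤ _ at hint
      linarith
end

section
/- For every T > 0, T·𝓛(1/T) = min { ∫₀ᵀ L(ξ(τ), ξ'(τ)) dτ : ξ : [0,T] → [0,1] absolutely continuous, ξ(0) = 0, ξ(T) = 1 }, and the minimum is attained. -/
/-- `𝓛(λ) := sup_{ρ ≥ b₀} (ρλ − 𝓗(ρ))`, the Fenchel transform of the discrete
Hamiltonian `𝓗`. -/
noncomputable def curlyL (𝓗 : ℝ → ℝ) (b₀ lam : ℝ) : ℝ :=
  sSup ((fun ρ => ρ * lam - 𝓗 ρ) '' Set.Ici b₀)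

/-- The Lagrangian `L(s,λ) := sup_ρ (ρλ − H(s,ρ))`, Fenchel transform of
`H(s,·)`. -/
noncomputable def fenchelL (H : ℝ → ℝ → ℝ) (s lam : ℝ) : ℝ :=
  sSup (Set.range fun ρ => ρ * lam - H s ρ)

/-- `ξ` is absolutely continuous on `[t₀,t₁]` with a.e. derivative `v`. -/
def IsACOn (ξ v : ℝ → ℝ) (t₀ t₁ : ℝ) : Prop :=
  MeasureTheory.IntegrableOn v (Set.Icc t₀ t₁) ∧
  ∀ t ∈ Set.Icc t₀ t₁, ξ t = ξ t₀ + ∫ τ in t₀..t, v τ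

open Set Filter Topology MeasureTheory

theorem IsACOn.continuousOn {ξ v : ℝ → ℝ} {t₀ t₁ : ℝ} (h : t₀ ≤ t₁) (hξ : IsACOn ξ v t₀ t₁) :
    ContinuousOn ξ (Icc t₀ t₁) :=
  (continuousOn_const.add (by
    simpa only [uIcc_of_le h] using intervalIntegral.continuousOn_primitive_interval
      (show IntegrableOn v (uIcc t₀ t₁) by rw [uIcc_of_le h]; exact hξ.1))).congr
    fun t ht => hξ.2 t ht

theorem LipschitzOnWith.comp_absolutelyContinuousOnInterval {f g : ℝ → ℝ} {a b : ℝ}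
    {K : NNReal} {s : Set ℝ} (hg : LipschitzOnWith K g s)
    (hf : AbsolutelyContinuousOnInterval f a b) (hs : MapsTo f (uIcc a b) s) :
    AbsolutelyContinuousOnInterval (g ∘ f) a b := by
  rw [absolutelyContinuousOnInterval_iff] at hf ⊢
  intro ε hε
  obtain ⟨δ, hδ, H⟩ := hf (ε / (K + 1)) (by positivity)
  refine ⟨δ, hδ, fun E hE hE' => ?_⟩
  have h1 := H E hE hE'
  calc _ ≤ ∑ i ∈ Finset.range E.1, K * dist (f (E.2 i).1) (f (E.2 i).2) :=
        Finset.sum_le_sum fun i hi =>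
          hg.dist_le_mul _ (hs (hE.1 i hi).1) _ (hs (hE.1 i hi).2)
    _ = K * ∑ i ∈ Finset.range E.1, dist (f (E.2 i).1) (f (E.2 i).2) :=
        (Finset.mul_sum _ _ _).symm
    _ ≤ K * (ε / (K + 1)) := by gcongr
    _ < (K + 1) * (ε / (K + 1)) := by gcongr; linarith
    _ = ε := by field

/-- Change of variables along an absolutely continuous curve. -/
theorem IsACOn.integral_comp_mul {ξ v g : ℝ → ℝ} {t₀ t₁ : ℝ} (h : t₀ ≤ t₁)
    (hξ : IsACOn ξ v t₀ t₁) (hg : Continuous g) :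
    ∫ τ in t₀..t₁, g (ξ τ) * v τ = ∫ s in ξ t₀..ξ t₁, g s := by
  have hv : IntervalIntegrable v volume t₀ t₁ :=
    (intervalIntegrable_iff_integrableOn_Icc_of_le h).2 hξ.1
  let y : ℝ → ℝ := fun t => ξ t₀ + ∫ τ in t₀..t, v τ
  have hyξ : ∀ t ∈ Icc t₀ t₁, y t = ξ t := fun t ht => (hξ.2 t ht).symm
  let G : ℝ → ℝ := fun x => ∫ s in ξ t₀..x, g s
  have hG : ∀ x, HasDerivAt G (g x) x := fun x =>
    intervalIntegral.integral_hasDerivAt_right (hg.intervalIntegrable _ _)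
      (hg.stronglyMeasurableAtFilter _ _) hg.continuousAt
  have hGc : ContDiff ℝ 1 G :=
    contDiff_one_iff_deriv.2 ⟨fun x => (hG x).differentiableAt, by
      rwa [show deriv G = g from funext fun x => (hG x).deriv]⟩
  have hint := hv.absolutelyContinuousOnInterval_intervalIntegral (c := t₀) (by simp)
  have hy : AbsolutelyContinuousOnInterval y t₀ t₁ :=
    ((contDiffOn_const (c := ξ t₀)).absolutelyContinuousOnInterval).fun_add hint
  obtain ⟨C, hC⟩ := hy.exists_bound
  obtain ⟨K, hK⟩ := (hGc.contDiffOn (s := Icc (-C) C)).exists_lipschitzOnWith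
    (by decide) (convex_Icc _ _) isCompact_Icc
  have hGy : AbsolutelyContinuousOnInterval (G ∘ y) t₀ t₁ :=
    hK.comp_absolutelyContinuousOnInterval hy fun t ht => abs_le.1 (hC t ht)
  have key := hGy.integral_deriv_eq_sub
  have e0 : y t₀ = ξ t₀ := hyξ _ ⟨le_rfl, h⟩
  have e1 : y t₁ = ξ t₁ := hyξ _ ⟨h, le_rfl⟩
  simp only [Function.comp, e0, e1] at key
  have hG0 : G (ξ t₀) = 0 := by simp [G]
  rw [hG0, sub_zero] at key
  refine Eq.trans ?_ key
  refine intervalIntegral.integral_congr_ae ?_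
  filter_upwards [hv.ae_hasDerivAt_integral] with t ht hmem
  rw [uIoc_of_le h] at hmem
  have htI : t ∈ Icc t₀ t₁ := Ioc_subset_Icc_self hmem
  have h1 : HasDerivAt y (v t) t :=
    (ht (by rwa [uIcc_of_le h]) t₀ (by simp)).const_add _
  have h2 : HasDerivAt (G ∘ y) (g (y t) * v t) t := (hG (y t)).comp t h1
  rw [h2.deriv, hyξ t htI]

/-- A superlinear convex Hamiltonian, defined for all `s : ℝ`. -/
structure IsTonelli (H : ℝ → ℝ → ℝ) : Prop where
  cont : Continuous (fun p : ℝ × ℝ => H p.1 p.2)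
  diff : ∀ s, Differentiable ℝ (H s)
  conv : ∀ s, StrictConvexOn ℝ univ (H s)
  superlinear : ∀ C : ℝ, ∃ R : ℝ, ∀ s ρ : ℝ, R ≤ |ρ| → C ≤ H s ρ / |ρ|

theorem StrictConvexOn.tangent_lt {f : ℝ → ℝ} (hf : StrictConvexOn ℝ univ f)
    (hd : Differentiable ℝ f) {x y : ℝ} (hxy : x ≠ y) : f x + deriv f x * (y - x) < f y := by
  rcases lt_or_gt_of_ne hxy with h | h
  · have := hf.deriv_lt_slope (mem_univ x) (mem_univ y) h (hd x)
    rw [slope_def_field, lt_div_iff₀ (by linarith)] at this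
    linarith
  · have := hf.slope_lt_deriv (mem_univ y) (mem_univ x) h (hd x)
    rw [slope_def_field, div_lt_iff₀ (by linarith)] at this
    linarith

namespace IsTonelli

variable {H : ℝ → ℝ → ℝ}

theorem tangent_le (hH : IsTonelli H) (s x y : ℝ) : H s x + deriv (H s) x * (y - x) ≤ H s y := by
  rcases eq_or_ne x y with rfl | h
  · simp
  · exact ((hH.conv s).tangent_lt (hH.diff s) h).le

theorem deriv_strictMono (hH : IsTonelli H) (s : ℝ) : StrictMono (deriv (H s)) :=
  strictMonoOn_univ.1 ((hH.conv s).strictMonoOn_deriv fun x _ => hH.diff s x)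

theorem tendsto_cocompact (hH : IsTonelli H) (s : ℝ) : Tendsto (H s) (cocompact ℝ) atTop := by
  obtain ⟨R, hR⟩ := hH.superlinear 1
  have hn : Tendsto (fun x : ℝ => |x|) (cocompact ℝ) atTop := tendsto_norm_cocompact_atTop
  refine tendsto_atTop_mono' _ ?_ hn
  filter_upwards [hn.eventually_ge_atTop (max R 1)] with ρ hρ
  have h1 := hR s ρ ((le_max_left _ _).trans hρ)
  have h2 : 0 < |ρ| := by linarith [le_max_right R 1]
  rwa [one_le_div h2] at h1

theorem continuous_deriv (hH : IsTonelli H) :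
    Continuous fun p : ℝ × ℝ => deriv (H p.1) p.2 := by
  have hslope : ∀ δ : ℝ, Continuous fun p : ℝ × ℝ => δ⁻¹ * (H p.1 (p.2 + δ) - H p.1 p.2) :=
    fun δ => continuous_const.mul ((hH.cont.comp
      (continuous_fst.prodMk (continuous_snd.add continuous_const))).sub hH.cont)
  refine continuous_iff_continuousAt.2 fun ⟨s, ρ⟩ => tendsto_order.2 ⟨fun c hc => ?_, fun c hc => ?_⟩
  · have hlim := (hH.diff s ρ).hasDerivAt.tendsto_slope_zero_left
    obtain ⟨δ, hδ, hδ0⟩ := ((hlim.eventually (lt_mem_nhds hc)).and self_mem_nhdsWithin).exists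
    have hδ0 : δ < 0 := hδ0
    filter_upwards [(hslope δ).continuousAt.eventually (lt_mem_nhds hδ)] with p hp
    refine hp.trans_le ?_
    have := hH.tangent_le p.1 p.2 (p.2 + δ)
    rw [inv_mul_eq_div, div_le_iff_of_neg hδ0]
    linarith
  · have hlim := (hH.diff s ρ).hasDerivAt.tendsto_slope_zero_right
    obtain ⟨δ, hδ, hδ0⟩ := ((hlim.eventually (gt_mem_nhds hc)).and self_mem_nhdsWithin).exists
    have hδ0 : 0 < δ := hδ0
    filter_upwards [(hslope δ).continuousAt.eventually (gt_mem_nhds hδ)] with p hp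
    refine lt_of_le_of_lt ?_ hp
    have := hH.tangent_le p.1 p.2 (p.2 + δ)
    rw [inv_mul_eq_div, le_div_iff₀ hδ0]
    linarith

theorem sigmaPlus_eq (hH : IsTonelli H) {a s r : ℝ} (hr : H s r = a) (hd : 0 ≤ deriv (H s) r) :
    sigmaPlus H a s = r := by
  refine IsGreatest.csSup_eq ⟨hr, fun x hx => ?_⟩
  by_contra! hlt
  have := (hH.conv s).tangent_lt (hH.diff s) hlt.ne
  have hx : H s x = a := hx
  nlinarith

theorem sigmaPlus_spec (hH : IsTonelli H) {a s : ℝ} (ha : ∃ ρ, H s ρ ≤ a) :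
    H s (sigmaPlus H a s) = a ∧ 0 ≤ deriv (H s) (sigmaPlus H a s) := by
  have hc : Continuous (H s) := (hH.diff s).continuous
  obtain ⟨m, hm⟩ := hc.exists_forall_le (hH.tendsto_cocompact s)
  obtain ⟨ρ, hρ⟩ := ha
  have htop : Tendsto (H s) atTop atTop := (hH.tendsto_cocompact s).mono_left atTop_le_cocompact
  obtain ⟨x, hx, hxm⟩ := ((htop.eventually_ge_atTop a).and (eventually_ge_atTop m)).exists
  obtain ⟨r, hr, hra⟩ := intermediate_value_Icc hxm hc.continuousOn ⟨(hm ρ).trans hρ, hx⟩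
  have hd0 : deriv (H s) m = 0 := (isMinOn_univ_iff.2 hm).isLocalMin univ_mem |>.deriv_eq_zero
  have hd : 0 ≤ deriv (H s) r := hd0 ▸ (hH.deriv_strictMono s).monotone hr.1
  rw [hH.sigmaPlus_eq hra hd]
  exact ⟨hra, hd⟩

theorem sigmaPlus_lt_iff (hH : IsTonelli H) {a s ρ : ℝ} (ha : ∃ ρ, H s ρ ≤ a) :
    sigmaPlus H a s < ρ ↔ 0 < deriv (H s) ρ ∧ a < H s ρ := by
  obtain ⟨h1, h2⟩ := hH.sigmaPlus_spec ha
  constructor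
  · intro h
    refine ⟨h2.trans_lt (hH.deriv_strictMono s h), ?_⟩
    have := (hH.conv s).tangent_lt (hH.diff s) h.ne
    nlinarith
  · rintro ⟨h3, h4⟩
    by_contra! h
    have := hH.tangent_le s ρ (sigmaPlus H a s)
    nlinarith

theorem lt_sigmaPlus_iff (hH : IsTonelli H) {a s ρ : ℝ} (ha : ∃ ρ, H s ρ ≤ a) :
    ρ < sigmaPlus H a s ↔ deriv (H s) ρ < 0 ∨ H s ρ < a := by
  obtain ⟨h1, h2⟩ := hH.sigmaPlus_spec ha
  constructor
  · intro h
    by_contra! hc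
    have := (hH.conv s).tangent_lt (hH.diff s) h.ne
    nlinarith
  · intro h
    by_contra! hc
    have h3 := hH.tangent_le s (sigmaPlus H a s) ρ
    have h4 := (hH.deriv_strictMono s).monotone hc
    rcases h with h | h <;> nlinarith

theorem continuous_sigmaPlus {X : Type*} [TopologicalSpace X] (hH : IsTonelli H) {a s : X → ℝ}
    (hac : Continuous a) (hsc : Continuous s) (ha : ∀ x, ∃ ρ, H (s x) ρ ≤ a x) :
    Continuous fun x => sigmaPlus H (a x) (s x) := by
  have hD : ∀ ρ, Continuous fun x => deriv (H (s x)) ρ := fun ρ =>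
    hH.continuous_deriv.comp (hsc.prodMk continuous_const)
  have hHρ : ∀ ρ, Continuous fun x => H (s x) ρ := fun ρ =>
    hH.cont.comp (hsc.prodMk continuous_const)
  refine continuous_iff_continuousAt.2 fun x => tendsto_order.2 ⟨fun c hc => ?_, fun c hc => ?_⟩
  · simp_rw [hH.lt_sigmaPlus_iff (ha _)] at hc ⊢
    rcases hc with hc | hc
    · exact ((hD c).continuousAt.eventually (gt_mem_nhds hc)).mono fun _ => Or.inl
    · exact ((hHρ c).continuousAt.eventually_lt hac.continuousAt hc).mono fun _ => Or.inr
  · simp_rw [gt_iff_lt, hH.sigmaPlus_lt_iff (ha _)] at hc ⊢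
    exact ((hD c).continuousAt.eventually (lt_mem_nhds hc.1)).and
      (hac.continuousAt.eventually_lt (hHρ c).continuousAt hc.2)

theorem sigmaPlus_mono (hH : IsTonelli H) {a b s : ℝ} (ha : ∃ ρ, H s ρ ≤ a) (hab : a ≤ b) :
    sigmaPlus H a s ≤ sigmaPlus H b s := by
  obtain ⟨h1, h2⟩ := hH.sigmaPlus_spec (ha.imp fun ρ h => h.trans hab)
  by_contra! h
  have h3 := (hH.lt_sigmaPlus_iff ha).1 h
  rcases h3 with h3 | h3 <;> linarith

theorem le_fenchelL (hH : IsTonelli H) (s lam ρ : ℝ) : ρ * lam - H s ρ ≤ fenchelL H s lam := by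
  refine le_csSup ?_ ⟨ρ, rfl⟩
  obtain ⟨R, hR⟩ := hH.superlinear |lam|
  have hc : Continuous fun ρ => ρ * lam - H s ρ :=
    (continuous_id.mul continuous_const).sub (hH.diff s).continuous
  obtain ⟨B, hB⟩ := (isCompact_Icc (a := -max R 1) (b := max R 1)).bddAbove_image hc.continuousOn
  refine ⟨max B 0, ?_⟩
  rintro _ ⟨x, rfl⟩
  rcases le_total |x| (max R 1) with hx | hx
  · exact le_max_of_le_left (hB ⟨x, abs_le.1 hx, rfl⟩)
  · refine le_max_of_le_right ?_
    have h1 := hR s x ((le_max_left _ _).trans hx)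
    rw [le_div_iff₀ (by linarith [le_max_right R 1]), ← abs_mul] at h1
    have h2 := le_abs_self (lam * x)
    dsimp only
    linarith

theorem fenchelL_deriv (hH : IsTonelli H) (s r : ℝ) :
    fenchelL H s (deriv (H s) r) = r * deriv (H s) r - H s r := by
  refine IsGreatest.csSup_eq ⟨⟨r, rfl⟩, ?_⟩
  rintro _ ⟨x, rfl⟩
  have := hH.tangent_le s r x
  dsimp only
  linarith

end IsTonelli

/-- If `1 / h` is integrable on `(0,1]`, the autonomous equation `η' = h(η)` has a solution that
crosses `[0,1]` in time `∫₀¹ 1 / h`. -/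
theorem exists_orderIso_solution {h : ℝ → ℝ} (hc : Continuous h) (h0 : ∀ s, 0 ≤ h s)
    (hne : ∀ᵐ s ∂volume.restrict (Ioc (0 : ℝ) 1), h s ≠ 0)
    (hint : IntegrableOn (fun s => (h s)⁻¹) (Ioc 0 1)) :
    ∃ η : ℝ ≃o ℝ, η 0 = 0 ∧ η (∫ s in (0 : ℝ)..1, (h s)⁻¹) = 1 ∧
      ∀ t ∈ Icc 0 (∫ s in (0 : ℝ)..1, (h s)⁻¹), η t = ∫ τ in (0 : ℝ)..t, h (η τ) := by
  classical
  let k : ℝ → ℝ := fun s => if s ∈ Ioc (0 : ℝ) 1 ∧ h s ≠ 0 then (h s)⁻¹ else 1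
  have hkpos : ∀ s, 0 < k s := fun s => by
    dsimp only [k]
    split_ifs with hs
    · exact inv_pos.2 ((h0 s).lt_of_ne' hs.2)
    · exact one_pos
  have hkmeas : Measurable k := by
    refine Measurable.ite ?_ hc.measurable.inv measurable_const
    exact measurableSet_Ioc.inter (hc.measurable (measurableSet_singleton 0)).compl
  have hbase : Integrable ((Ioc (0 : ℝ) 1).indicator fun s => (h s)⁻¹) :=
    hint.integrable_indicator measurableSet_Ioc
  have hkint : ∀ a b, IntervalIntegrable k volume a b := fun a b => by
    have : IntervalIntegrable (fun s => (Ioc (0 : ℝ) 1).indicator (fun s => (h s)⁻¹) s + 1)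
        volume a b := hbase.intervalIntegrable.add intervalIntegrable_const
    refine this.mono_fun' hkmeas.aestronglyMeasurable (Eventually.of_forall fun s => ?_)
    refine (Real.norm_of_nonneg (hkpos s).le).trans_le ?_
    dsimp only [k]
    have hinv : 0 ≤ (h s)⁻¹ := inv_nonneg.2 (h0 s)
    by_cases hs : s ∈ Ioc (0 : ℝ) 1
    · rw [indicator_of_mem hs]
      split_ifs <;> linarith
    · rw [indicator_of_notMem hs, if_neg fun h' => hs h'.1]
      linarith
  let t : ℝ → ℝ := fun x => ∫ s in (0 : ℝ)..x, k s
  have htsub : ∀ x y, t y - t x = ∫ s in x..y, k s := fun x y =>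
    intervalIntegral.integral_interval_sub_left (hkint _ _) (hkint _ _)
  have hmono : StrictMono t := fun x y hxy => by
    rw [← sub_pos, htsub]
    exact intervalIntegral.intervalIntegral_pos_of_pos (hkint _ _) hkpos hxy
  have htc : Continuous t := intervalIntegral.continuous_primitive hkint 0
  have htop : Tendsto t atTop atTop := by
    have : Tendsto (fun x : ℝ => t 1 + (x - 1)) atTop atTop :=
      tendsto_atTop_add_const_left _ _ (tendsto_atTop_add_const_right _ _ tendsto_id)
    refine this.congr' ?_
    filter_upwards [eventually_ge_atTop 1] with x hx
    have : ∫ s in (1 : ℝ)..x, k s = ∫ s in (1 : ℝ)..x, (1 : ℝ) := by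
      refine intervalIntegral.integral_congr_ae (Eventually.of_forall fun s hs => ?_)
      rw [uIoc_of_le hx] at hs
      exact if_neg fun h' => (h'.1.2.trans_lt hs.1).false
    have h2 := htsub 1 x
    rw [this] at h2
    simp at h2
    linarith
  have hbot : Tendsto t atBot atBot := by
    refine (tendsto_id (α := ℝ) (x := atBot)).congr' ?_
    filter_upwards [eventually_le_atBot 0] with x hx
    have : ∫ s in x..(0 : ℝ), k s = ∫ s in x..(0 : ℝ), (1 : ℝ) := by
      refine intervalIntegral.integral_congr_ae (Eventually.of_forall fun s hs => ?_)
      rw [uIoc_of_le hx] at hs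
      exact if_neg fun h' => (h'.1.1.trans_le hs.2).false
    have h2 := htsub x 0
    rw [this] at h2
    simp [t] at h2
    simp only [id, t]
    linarith
  have hk1 : ∀ x ∈ Icc (0 : ℝ) 1, ∀ g : ℝ → ℝ,
      ∫ s in (0 : ℝ)..x, g s * k s = ∫ s in (0 : ℝ)..x, g s * (h s)⁻¹ := fun x hx g => by
    refine intervalIntegral.integral_congr_ae ?_
    filter_upwards [(ae_restrict_iff' measurableSet_Ioc).1 hne] with s hs hs'
    rw [uIoc_of_le hx.1] at hs'
    have hs1 : s ∈ Ioc (0 : ℝ) 1 := ⟨hs'.1, hs'.2.trans hx.2⟩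
    simp only [k, if_pos (And.intro hs1 (hs hs1))]
  let e : ℝ ≃o ℝ := hmono.orderIsoOfSurjective t (htc.surjective htop hbot)
  have he : ∀ x, e.symm (t x) = x := fun x => e.symm_apply_apply x
  have ht0 : t 0 = 0 := by simp [t]
  have ht1 : t 1 = ∫ s in (0 : ℝ)..1, (h s)⁻¹ := by
    simpa using hk1 1 (by simp) fun _ => 1
  refine ⟨e.symm, by simpa [ht0] using he 0, by rw [← ht1]; exact he 1, fun τ hτ => ?_⟩
  obtain ⟨x, rfl⟩ := (htc.surjective htop hbot) τ
  rw [← ht1, ← ht0] at hτ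
  have hx : x ∈ Icc (0 : ℝ) 1 := ⟨hmono.le_iff_le.1 hτ.1, hmono.le_iff_le.1 hτ.2⟩
  have hac : IsACOn t k 0 x :=
    ⟨(intervalIntegrable_iff_integrableOn_Icc_of_le hx.1).1 (hkint _ _), fun y _ => by simp [t]⟩
  have key := hac.integral_comp_mul hx.1 (hc.comp e.symm.continuous)
  rw [ht0] at key
  simp only [Function.comp, he] at key
  rw [he, ← key, hk1 x hx]
  have : ∫ s in (0 : ℝ)..x, h s * (h s)⁻¹ = ∫ s in (0 : ℝ)..x, (1 : ℝ) := by
    refine intervalIntegral.integral_congr_ae ?_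
    filter_upwards [(ae_restrict_iff' measurableSet_Ioc).1 hne] with s hs hs'
    rw [uIoc_of_le hx.1] at hs'
    exact mul_inv_cancel₀ (hs ⟨hs'.1, hs'.2.trans hx.2⟩)
  rw [this]
  simp

/-- A solution of `η' = h(η)` that meets a zero of `h` can be delayed there. -/
theorem exists_delayed_solution {h η : ℝ → ℝ} {T₀ T t₀ : ℝ} (hc : Continuous h)
    (hη : Continuous η) (ht₀ : t₀ ∈ Icc 0 T₀) (hz : h (η t₀) = 0) (hT : T₀ ≤ T)
    (hsol : ∀ t ∈ Icc 0 T₀, η t = ∫ τ in (0 : ℝ)..t, h (η τ)) :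
    ∃ φ : ℝ → ℝ, Continuous φ ∧ φ 0 = 0 ∧ φ T = T₀ ∧ (∀ t ∈ Icc 0 T, φ t ∈ Icc 0 T₀) ∧
      ∀ t ∈ Icc 0 T, η (φ t) = ∫ τ in (0 : ℝ)..t, h (η (φ τ)) := by
  classical
  set t₁ := t₀ + (T - T₀) with ht₁
  have h01 : t₀ ≤ t₁ := by linarith
  have h1T : t₁ ≤ T := by linarith [ht₀.2]
  let χ : ℝ → ℝ := fun t => if t ∈ Ioc t₀ t₁ then 0 else 1
  have hχ0 : ∀ t, 0 ≤ χ t := fun t => by dsimp only [χ]; split_ifs <;> norm_num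
  have hχm : Measurable χ := Measurable.ite measurableSet_Ioc measurable_const measurable_const
  have hχi : ∀ a b, IntervalIntegrable χ volume a b := fun a b =>
    (intervalIntegrable_const (c := (1 : ℝ))).mono_fun hχm.aestronglyMeasurable
      (Eventually.of_forall fun t => by dsimp only [χ]; split_ifs <;> norm_num)
  let φ : ℝ → ℝ := fun t => ∫ τ in (0 : ℝ)..t, χ τ
  have hsub : ∀ x y, φ y - φ x = ∫ s in x..y, χ s := fun x y =>
    intervalIntegral.integral_interval_sub_left (hχi _ _) (hχi _ _)
  have hmono : Monotone φ := fun x y hxy => by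
    rw [← sub_nonneg, hsub]
    exact intervalIntegral.integral_nonneg hxy fun t _ => hχ0 t
  have hφ0 : φ 0 = 0 := by simp [φ]
  have hone : ∀ x y, x ≤ y → (y ≤ t₀ ∨ t₁ ≤ x) → φ y - φ x = y - x := fun x y hxy hd => by
    rw [hsub, ← mul_one (y - x), ← smul_eq_mul, ← intervalIntegral.integral_const]
    refine intervalIntegral.integral_congr_ae (Eventually.of_forall fun s hs => ?_)
    rw [uIoc_of_le hxy] at hs
    refine if_neg fun h' => ?_
    rcases hd with hd | hd
    · exact (h'.1.trans_le (hs.2.trans hd)).false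
    · exact (hs.1.trans_le (h'.2.trans hd)).false
  have hφt₀ : φ t₀ = t₀ := by
    have := hone 0 t₀ ht₀.1 (Or.inl le_rfl)
    rw [hφ0] at this
    linarith
  have hwait : ∀ t ∈ Ioc t₀ t₁, φ t = t₀ := fun t ht => by
    have : φ t - φ t₀ = 0 := by
      rw [hsub, ← intervalIntegral.integral_zero (a := t₀) (b := t) (μ := volume)]
      refine intervalIntegral.integral_congr_ae (Eventually.of_forall fun s hs => ?_)
      rw [uIoc_of_le ht.1.le] at hs
      exact if_pos ⟨hs.1, hs.2.trans ht.2⟩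
    linarith
  have hφt₁ : φ t₁ = t₀ := by
    rcases h01.eq_or_lt with h' | h'
    · rw [← h', hφt₀]
    · exact hwait _ ⟨h', le_rfl⟩
  have hφT : φ T = T₀ := by
    have := hone t₁ T h1T (Or.inr le_rfl)
    linarith
  have hmem : ∀ t ∈ Icc 0 T, φ t ∈ Icc 0 T₀ := fun t ht =>
    ⟨hφ0 ▸ hmono ht.1, hφT ▸ hmono ht.2⟩
  refine ⟨φ, intervalIntegral.continuous_primitive hχi 0, hφ0, hφT, hmem, fun t ht => ?_⟩
  have hac : IsACOn φ χ 0 t :=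
    ⟨(intervalIntegrable_iff_integrableOn_Icc_of_le ht.1).1 (hχi _ _), fun y _ => by simp [φ]⟩
  have key := hac.integral_comp_mul ht.1 (hc.comp hη)
  rw [hφ0] at key
  rw [hsol _ (hmem t ht)]
  simp only [Function.comp] at key
  rw [← key]
  refine intervalIntegral.integral_congr fun s _ => ?_
  by_cases hs : s ∈ Ioc t₀ t₁
  · simp [hwait s hs, hz]
  · simp only [χ, if_neg hs, mul_one]

/-- The speed `∂H/∂ρ(s, σ⁺_a(s))` of the motion with energy `a`. -/
noncomputable def energySpeed (H : ℝ → ℝ → ℝ) (a s : ℝ) : ℝ :=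
  deriv (H s) (sigmaPlus H a s)

namespace IsTonelli

variable {H : ℝ → ℝ → ℝ}

theorem continuous_energySpeed {X : Type*} [TopologicalSpace X] (hH : IsTonelli H) {a s : X → ℝ}
    (hac : Continuous a) (hsc : Continuous s) (ha : ∀ x, ∃ ρ, H (s x) ρ ≤ a x) :
    Continuous fun x => energySpeed H (a x) (s x) :=
  hH.continuous_deriv.comp (hsc.prodMk (hH.continuous_sigmaPlus hac hsc ha))

theorem energySpeed_nonneg (hH : IsTonelli H) {a s : ℝ} (ha : ∃ ρ, H s ρ ≤ a) :
    0 ≤ energySpeed H a s :=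
  (hH.sigmaPlus_spec ha).2

theorem energySpeed_pos (hH : IsTonelli H) {a s : ℝ} (ha : ∃ ρ, H s ρ < a) :
    0 < energySpeed H a s := by
  obtain ⟨ρ, hρ⟩ := ha
  obtain ⟨h1, h2⟩ := hH.sigmaPlus_spec ⟨ρ, hρ.le⟩
  refine h2.lt_of_ne fun h => ?_
  have := hH.tangent_le s (sigmaPlus H a s) ρ
  rw [← h] at this
  linarith

theorem energySpeed_eq_zero (hH : IsTonelli H) {a s : ℝ} (ha : ∃ ρ, H s ρ ≤ a)
    (hmin : ∀ ρ, a ≤ H s ρ) : energySpeed H a s = 0 := by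
  have : IsMinOn (H s) univ (sigmaPlus H a s) :=
    isMinOn_univ_iff.2 fun ρ => (hH.sigmaPlus_spec ha).1.trans_le (hmin ρ)
  exact (this.isLocalMin univ_mem).deriv_eq_zero

theorem exists_le_energySpeed (hH : IsTonelli H) {A : ℝ} (hA : ∀ s, ∃ ρ, H s ρ ≤ A) (c : ℝ) :
    ∃ a, A < a ∧ ∀ s ∈ Icc (0 : ℝ) 1, c ≤ energySpeed H a s := by
  have hbdd : ∀ ρ, ∃ M, ∀ s ∈ Icc (0 : ℝ) 1, H s ρ ≤ M := fun ρ => by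
    obtain ⟨M, hM⟩ := (isCompact_Icc (a := (0 : ℝ)) (b := 1)).bddAbove_image
      (hH.cont.comp (continuous_id.prodMk continuous_const)).continuousOn
    exact ⟨M, fun s hs => hM ⟨s, hs, rfl⟩⟩
  obtain ⟨M, hM⟩ := hbdd 0
  obtain ⟨R, hR⟩ := hH.superlinear (c + max M 0)
  obtain ⟨N, hN⟩ := hbdd (max R 1)
  refine ⟨max A N + 1, by linarith [le_max_left A N], fun s hs => ?_⟩
  have ha : ∃ ρ, H s ρ ≤ max A N + 1 :=
    (hA s).imp fun ρ hρ => by linarith [le_max_left A N]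
  have hlt : max R 1 < sigmaPlus H (max A N + 1) s :=
    (hH.lt_sigmaPlus_iff ha).2 (Or.inr (by linarith [hN s hs, le_max_right A N]))
  obtain ⟨r, hr⟩ : ∃ r, r = sigmaPlus H (max A N + 1) s := ⟨_, rfl⟩
  have ht := hH.tangent_le s r 0
  unfold energySpeed
  rw [← hr] at hlt ⊢
  have hr1 : 1 < r := (le_max_right _ _).trans_lt hlt
  have h1 := hR s r (((le_max_left _ _).trans hlt.le).trans (le_abs_self r))
  rw [abs_of_pos (by linarith), le_div_iff₀ (by linarith)] at h1
  have h2 := hM s hs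
  have h3 : max M 0 ≤ max M 0 * r := le_mul_of_one_le_right (le_max_right _ _) hr1.le
  have h4 := le_max_left M 0
  have h5 : c * r ≤ deriv (H s) r * r := by linarith
  exact le_of_mul_le_mul_right h5 (by linarith)

/-- For every travel time `T` there is an energy level `a` and a motion crossing `[0,1]` in time
`T` with energy `a`. -/
theorem exists_motion (hH : IsTonelli H) {A T : ℝ} (hT : 0 < T) (hA : ∀ s, ∃ ρ, H s ρ ≤ A)
    (hmin : ∃ s ∈ Icc (0 : ℝ) 1, ∀ ρ, A ≤ H s ρ) :
    ∃ a, A ≤ a ∧ ∃ ξ : ℝ → ℝ, Continuous ξ ∧ ξ 0 = 0 ∧ ξ T = 1 ∧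
      ∀ t ∈ Icc 0 T, ξ t ∈ Icc (0 : ℝ) 1 ∧ ξ t = ∫ τ in (0 : ℝ)..t, energySpeed H a (ξ τ) := by
  let F : ℝ → ℝ := fun x => ∫ s in (0 : ℝ)..1, (energySpeed H (A + Real.exp x) s)⁻¹
  have hlt : ∀ x s, ∃ ρ, H s ρ < A + Real.exp x := fun x s =>
    (hA s).imp fun ρ hρ => by linarith [Real.exp_pos x]
  have hcs : ∀ a, A ≤ a → Continuous (energySpeed H a) := fun a ha =>
    hH.continuous_energySpeed continuous_const continuous_id
      fun s => (hA s).imp fun ρ hρ => hρ.trans ha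
  have hjoint : Continuous fun p : ℝ × ℝ => energySpeed H (A + Real.exp p.1) p.2 :=
    hH.continuous_energySpeed (a := fun p : ℝ × ℝ => A + Real.exp p.1) (s := fun p => p.2)
      (by fun_prop) continuous_snd fun p => (hlt p.1 p.2).imp fun _ h => h.le
  have hinvc : Continuous fun p : ℝ × ℝ => (energySpeed H (A + Real.exp p.1) p.2)⁻¹ :=
    hjoint.inv₀ fun p => (hH.energySpeed_pos (hlt p.1 p.2)).ne'
  have hFc : Continuous F :=
    intervalIntegral.continuous_parametric_intervalIntegral_of_continuous' hinvc 0 1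
  by_cases hx : ∃ x, T ≤ F x
  · obtain ⟨x₀, hx₀⟩ := hx
    obtain ⟨a₁, ha₁, hs₁⟩ := hH.exists_le_energySpeed hA T⁻¹
    have hle : F (Real.log (a₁ - A)) ≤ T := by
      have he : A + Real.exp (Real.log (a₁ - A)) = a₁ := by
        rw [Real.exp_log (by linarith)]; ring
      have hc1 : Continuous fun s => (energySpeed H (A + Real.exp (Real.log (a₁ - A))) s)⁻¹ :=
        hinvc.comp (continuous_const.prodMk continuous_id)
      have := intervalIntegral.integral_mono_on zero_le_one
        (hc1.intervalIntegrable (μ := volume) 0 1)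
        (intervalIntegrable_const (c := T)) fun s hs => by
          rw [he]
          exact inv_le_of_inv_le₀ hT (hs₁ s hs)
      simpa using this
    obtain ⟨x, hx⟩ := mem_range_of_exists_le_of_exists_ge hFc ⟨_, hle⟩ ⟨_, hx₀⟩
    have hpos : ∀ s, 0 < energySpeed H (A + Real.exp x) s := fun s =>
      hH.energySpeed_pos (hlt x s)
    have hA' : A ≤ A + Real.exp x := by linarith [Real.exp_pos x]
    have hci : Continuous fun s => (energySpeed H (A + Real.exp x) s)⁻¹ :=
      hinvc.comp (continuous_const.prodMk continuous_id)
    obtain ⟨η, h0, h1, hsol⟩ := exists_orderIso_solution (hcs _ hA') (fun s => (hpos s).le)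
      (Eventually.of_forall fun s => (hpos s).ne')
      hci.integrableOn_Ioc
    change ∫ s in (0 : ℝ)..1, (energySpeed H (A + Real.exp x) s)⁻¹ = T at hx
    rw [hx] at h1 hsol
    exact ⟨_, hA', η, η.continuous, h0, h1, fun t ht =>
      ⟨⟨h0 ▸ η.monotone ht.1, h1 ▸ η.monotone ht.2⟩, hsol t ht⟩⟩
  · push Not at hx
    have hnn : ∀ s, 0 ≤ energySpeed H A s := fun s => hH.energySpeed_nonneg (hA s)
    have hcA := hcs A le_rfl
    have hlint : ∫⁻ s in Ioc (0 : ℝ) 1, (ENNReal.ofReal (energySpeed H A s))⁻¹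
        ≤ ENNReal.ofReal T := by
      let f : ℕ → ℝ → ENNReal := fun n s =>
        (ENNReal.ofReal (energySpeed H (A + Real.exp (-(n : ℝ))) s))⁻¹
      have hf : ∀ n, ∫⁻ s in Ioc (0 : ℝ) 1, f n s ≤ ENNReal.ofReal T := fun n => by
        have hci : Continuous fun s => (energySpeed H (A + Real.exp (-(n : ℝ))) s)⁻¹ :=
          hinvc.comp (continuous_const.prodMk continuous_id)
        have hpos : ∀ s, 0 < energySpeed H (A + Real.exp (-(n : ℝ))) s := fun s =>
          hH.energySpeed_pos (hlt _ s)
        have := ofReal_integral_eq_lintegral_ofReal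
          (hci.integrableOn_Ioc (μ := volume) (a := 0) (b := 1))
          (Eventually.of_forall fun s => (inv_pos.2 (hpos s)).le)
        simp only [f, ← ENNReal.ofReal_inv_of_pos (hpos _)]
        rw [← this, ← intervalIntegral.integral_of_le zero_le_one]
        exact ENNReal.ofReal_le_ofReal (hx _).le
      have hlim : ∀ s, Tendsto (fun n => f n s) atTop
          (𝓝 (ENNReal.ofReal (energySpeed H A s))⁻¹) := fun s => by
        have hcont : Continuous fun y : ℝ => energySpeed H (A + |y|) s :=
          hH.continuous_energySpeed (a := fun y : ℝ => A + |y|) (s := fun _ => s)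
            (by fun_prop) continuous_const
            fun y => (hA s).imp fun ρ hρ => by linarith [abs_nonneg y]
        have he : Tendsto (fun n : ℕ => Real.exp (-(n : ℝ))) atTop (𝓝 0) :=
          Real.tendsto_exp_neg_atTop_nhds_zero.comp tendsto_natCast_atTop_atTop
        have h1 := (hcont.tendsto 0).comp he
        simp only [Function.comp_def, abs_zero, add_zero, Real.abs_exp] at h1
        exact tendsto_inv_iff.2 (ENNReal.tendsto_ofReal h1)
      calc ∫⁻ s in Ioc (0 : ℝ) 1, (ENNReal.ofReal (energySpeed H A s))⁻¹
          = ∫⁻ s in Ioc (0 : ℝ) 1, liminf (fun n => f n s) atTop := by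
            simp only [(hlim _).liminf_eq]
        _ ≤ liminf (fun n => ∫⁻ s in Ioc (0 : ℝ) 1, f n s) atTop :=
            lintegral_liminf_le fun n => (ENNReal.measurable_ofReal.comp
              (hcs _ (by linarith [Real.exp_pos (-(n : ℝ))])).measurable).inv
        _ ≤ ENNReal.ofReal T :=
            liminf_le_of_frequently_le' (Eventually.of_forall hf).frequently
    have hmeas : Measurable fun s => (ENNReal.ofReal (energySpeed H A s))⁻¹ :=
      (ENNReal.measurable_ofReal.comp hcA.measurable).inv
    have hne : ∀ᵐ s ∂volume.restrict (Ioc (0 : ℝ) 1), energySpeed H A s ≠ 0 := by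
      filter_upwards [ae_lt_top hmeas (hlint.trans_lt ENNReal.ofReal_lt_top).ne] with s hs h0
      simp [h0] at hs
    have hlint' : ∫⁻ s in Ioc (0 : ℝ) 1, ENNReal.ofReal (energySpeed H A s)⁻¹
        ≤ ENNReal.ofReal T := by
      refine (lintegral_mono_ae ?_).trans hlint
      filter_upwards [hne] with s hs
      rw [ENNReal.ofReal_inv_of_pos ((hnn s).lt_of_ne' hs)]
    have hinn : 0 ≤ᵐ[volume.restrict (Ioc (0 : ℝ) 1)] fun s => (energySpeed H A s)⁻¹ :=
      Eventually.of_forall fun s => inv_nonneg.2 (hnn s)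
    have him : AEStronglyMeasurable (fun s => (energySpeed H A s)⁻¹)
        (volume.restrict (Ioc (0 : ℝ) 1)) := hcA.measurable.inv.aestronglyMeasurable
    have hint : IntegrableOn (fun s => (energySpeed H A s)⁻¹) (Ioc 0 1) :=
      ⟨him, (hasFiniteIntegral_iff_ofReal hinn).2 (hlint'.trans_lt ENNReal.ofReal_lt_top)⟩
    have hT₀ : ∫ s in (0 : ℝ)..1, (energySpeed H A s)⁻¹ ≤ T := by
      rw [intervalIntegral.integral_of_le zero_le_one, integral_eq_lintegral_of_nonneg_ae hinn him]
      exact ENNReal.toReal_le_of_le_ofReal hT.le hlint'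
    obtain ⟨η, h0, h1, hsol⟩ := exists_orderIso_solution hcA hnn hne hint
    obtain ⟨s₀, hs₀, hmin⟩ := hmin
    obtain ⟨t₀, rfl⟩ := η.surjective s₀
    have ht₀ : t₀ ∈ Icc 0 (∫ s in (0 : ℝ)..1, (energySpeed H A s)⁻¹) := by
      exact ⟨η.le_iff_le.1 (h0.trans_le hs₀.1), η.le_iff_le.1 (hs₀.2.trans_eq h1.symm)⟩
    obtain ⟨φ, hφc, hφ0, hφT, hφm, hφ⟩ := exists_delayed_solution hcA η.continuous ht₀
      (hH.energySpeed_eq_zero (hA _) hmin) hT₀ hsol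
    refine ⟨A, le_rfl, η ∘ φ, η.continuous.comp hφc, by simp [hφ0, h0], by simp [hφT, h1],
      fun t ht => ⟨⟨?_, ?_⟩, hφ t ht⟩⟩
    · exact h0 ▸ η.monotone (hφm t ht).1
    · exact h1 ▸ η.monotone (hφm t ht).2

theorem sub_le_action (hH : IsTonelli H) {a T : ℝ} (hT : 0 < T) (ha : ∀ s, ∃ ρ, H s ρ ≤ a)
    {ξ v : ℝ → ℝ} (hac : IsACOn ξ v 0 T) (h0 : ξ 0 = 0) (h1 : ξ T = 1)
    (hL : IntervalIntegrable (fun τ => fenchelL H (ξ τ) (v τ)) volume 0 T) :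
    sigmaFn H a - T * a ≤ ∫ τ in (0 : ℝ)..T, fenchelL H (ξ τ) (v τ) := by
  have hσ : Continuous (sigmaPlus H a) :=
    hH.continuous_sigmaPlus continuous_const continuous_id ha
  have hv : IntervalIntegrable v volume 0 T :=
    (intervalIntegrable_iff_integrableOn_Icc_of_le hT.le).2 hac.1
  have hi : IntervalIntegrable (fun τ => sigmaPlus H a (ξ τ) * v τ) volume 0 T :=
    hv.continuousOn_mul (by
      rw [uIcc_of_le hT.le]; exact hσ.comp_continuousOn (hac.continuousOn hT.le))
  have key := hac.integral_comp_mul hT.le hσ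
  rw [h0, h1] at key
  have : ∫ τ in (0 : ℝ)..T, (sigmaPlus H a (ξ τ) * v τ - a) = sigmaFn H a - T * a := by
    rw [intervalIntegral.integral_sub hi intervalIntegrable_const, key]
    simp [sigmaFn]
  rw [← this]
  refine intervalIntegral.integral_mono_on hT.le (hi.sub intervalIntegrable_const) hL fun τ _ => ?_
  have := hH.le_fenchelL (ξ τ) (v τ) (sigmaPlus H a (ξ τ))
  rwa [(hH.sigmaPlus_spec (ha _)).1] at this

theorem fenchelL_energySpeed (hH : IsTonelli H) {a s : ℝ} (ha : ∃ ρ, H s ρ ≤ a) :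
    fenchelL H s (energySpeed H a s) = sigmaPlus H a s * energySpeed H a s - a := by
  have := hH.fenchelL_deriv s (sigmaPlus H a s)
  rwa [(hH.sigmaPlus_spec ha).1] at this

/-- The least action is attained, and equals `σ(a) - T a` for the maximizing energy level `a`. -/
theorem exists_minimizer (hH : IsTonelli H) {A T : ℝ} (hT : 0 < T) (hA : ∀ s, ∃ ρ, H s ρ ≤ A)
    (hmin : ∃ s ∈ Icc (0 : ℝ) 1, ∀ ρ, A ≤ H s ρ) :
    ∃ a, A ≤ a ∧ ∃ ξ v : ℝ → ℝ, IsACOn ξ v 0 T ∧ ξ 0 = 0 ∧ ξ T = 1 ∧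
      (∀ t ∈ Icc 0 T, ξ t ∈ Icc (0 : ℝ) 1) ∧
      IntervalIntegrable (fun τ => fenchelL H (ξ τ) (v τ)) volume 0 T ∧
      ∫ τ in (0 : ℝ)..T, fenchelL H (ξ τ) (v τ) = sigmaFn H a - T * a := by
  obtain ⟨a, ha, ξ, hξ, h0, h1, hsol⟩ := hH.exists_motion hT hA hmin
  have ha' : ∀ s, ∃ ρ, H s ρ ≤ a := fun s => (hA s).imp fun ρ hρ => hρ.trans ha
  have hσ : Continuous (sigmaPlus H a) :=
    hH.continuous_sigmaPlus continuous_const continuous_id ha'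
  have hv : Continuous fun τ => energySpeed H a (ξ τ) :=
    hH.continuous_energySpeed continuous_const hξ fun τ => ha' _
  have hac : IsACOn ξ (fun τ => energySpeed H a (ξ τ)) 0 T :=
    ⟨hv.integrableOn_Icc, fun t ht => by rw [h0, zero_add]; exact (hsol t ht).2⟩
  have hi : Continuous fun τ => sigmaPlus H a (ξ τ) * energySpeed H a (ξ τ) :=
    (hσ.comp hξ).mul hv
  refine ⟨a, ha, ξ, _, hac, h0, h1, fun t ht => (hsol t ht).1, ?_, ?_⟩
  · simp only [hH.fenchelL_energySpeed (ha' _)]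
    exact (hi.sub continuous_const).intervalIntegrable _ _
  · have key := hac.integral_comp_mul hT.le hσ
    rw [h0, h1] at key
    simp only [hH.fenchelL_energySpeed (ha' _)]
    rw [intervalIntegral.integral_sub (hi.intervalIntegrable _ _) intervalIntegrable_const, key]
    simp [sigmaFn]

theorem sigmaFn_mono (hH : IsTonelli H) {a b : ℝ} (ha : ∀ s, ∃ ρ, H s ρ ≤ a) (hab : a ≤ b) :
    sigmaFn H a ≤ sigmaFn H b := by
  have hb : ∀ s, ∃ ρ, H s ρ ≤ b := fun s => (ha s).imp fun ρ hρ => hρ.trans hab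
  exact intervalIntegral.integral_mono_on zero_le_one
    ((hH.continuous_sigmaPlus continuous_const continuous_id ha).intervalIntegrable _ _)
    ((hH.continuous_sigmaPlus continuous_const continuous_id hb).intervalIntegrable _ _)
    fun s _ => hH.sigmaPlus_mono (ha s) hab

theorem exists_forall_le (hH : IsTonelli H) (s : ℝ) : ∃ m, ∀ ρ, H s m ≤ H s ρ :=
  (hH.diff s).continuous.exists_forall_le (hH.tendsto_cocompact s)

/-- The critical value is a maximum over `s ∈ [0,1]` of the minima of `H(s,·)`. -/
theorem isGreatest_a0 (hH : IsTonelli H) :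
    IsGreatest ((fun s => sInf (range (H s))) '' Icc (0 : ℝ) 1) (a0 H) := by
  have hb : ∀ s, BddBelow (range (H s)) := fun s => by
    obtain ⟨m, hm⟩ := hH.exists_forall_le s
    exact ⟨H s m, forall_mem_range.2 hm⟩
  have husc : UpperSemicontinuous fun s => sInf (range (H s)) :=
    upperSemicontinuous_ciInf (f := fun ρ s => H s ρ) hb fun ρ =>
      (hH.cont.comp (continuous_id.prodMk continuous_const)).upperSemicontinuous
  obtain ⟨s, hs, hmax⟩ := (husc.upperSemicontinuousOn _).exists_isMaxOn
    (nonempty_Icc.2 zero_le_one) (isCompact_Icc (a := (0 : ℝ)) (b := 1))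
  have h : IsGreatest ((fun s => sInf (range (H s))) '' Icc (0 : ℝ) 1) (sInf (range (H s))) :=
    ⟨⟨s, hs, rfl⟩, forall_mem_image.2 fun x hx => hmax hx⟩
  rwa [a0, h.csSup_eq]

theorem isLeast_sInf_range (hH : IsTonelli H) (s : ℝ) : IsLeast (range (H s)) (sInf (range (H s))) := by
  obtain ⟨m, hm⟩ := hH.exists_forall_le s
  have h : IsLeast (range (H s)) (H s m) := ⟨⟨m, rfl⟩, forall_mem_range.2 hm⟩
  rwa [h.csInf_eq]

end IsTonelli

/-- for every `T > 0`,
`T·𝓛(1/T)` is the minimum of `∫₀ᵀ L(ξ,ξ') dτ` over absolutely continuous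
curves `ξ : [0,T] → [0,1]` with `ξ(0) = 0` and `ξ(T) = 1`. -/
theorem stmt17 (H : ℝ → ℝ → ℝ)
    (hHcont : ContinuousOn (fun p : ℝ × ℝ => H p.1 p.2)
      (Set.Icc (0 : ℝ) 1 ×ˢ (Set.univ : Set ℝ)))
    (hHdiff : ∀ s ∈ Set.Icc (0 : ℝ) 1, ContDiff ℝ 1 (H s))
    (hHconv : ∀ s ∈ Set.Icc (0 : ℝ) 1, StrictConvexOn ℝ (Set.univ : Set ℝ) (H s))
    (hHsup : ∀ C : ℝ, ∃ R : ℝ, ∀ s ∈ Set.Icc (0 : ℝ) 1, ∀ ρ : ℝ,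
      R ≤ |ρ| → C ≤ H s ρ / |ρ|)
    (𝓗 : ℝ → ℝ)
    (h𝓗₁ : ∀ a ∈ Set.Ici (a0 H), 𝓗 (sigmaFn H a) = a)
    (h𝓗₂ : ∀ ρ ∈ Set.Ici (sigmaFn H (a0 H)), sigmaFn H (𝓗 ρ) = ρ)
    (h𝓗₃ : ∀ ρ ∈ Set.Ici (sigmaFn H (a0 H)), 𝓗 ρ ∈ Set.Ici (a0 H))
    (T : ℝ) (hT : 0 < T) :
    IsLeast
      {A : ℝ | ∃ ξ v : ℝ → ℝ,
        IsACOn ξ v 0 T ∧ ξ 0 = 0 ∧ ξ T = 1 ∧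
        (∀ t ∈ Set.Icc (0 : ℝ) T, ξ t ∈ Set.Icc (0 : ℝ) 1) ∧
        IntervalIntegrable (fun τ => fenchelL H (ξ τ) (v τ))
          MeasureTheory.volume 0 T ∧
        A = ∫ τ in (0 : ℝ)..T, fenchelL H (ξ τ) (v τ)}
      (T * curlyL 𝓗 (sigmaFn H (a0 H)) (1 / T)) := by
  let K : ℝ → ℝ → ℝ := fun s => H (projIcc 0 1 zero_le_one s)
  have hKH : ∀ s ∈ Icc (0 : ℝ) 1, K s = H s := fun s hs => by
    simp only [K, projIcc_of_mem _ hs]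
  have hproj : ∀ s, (projIcc (0 : ℝ) 1 zero_le_one s : ℝ) ∈ Icc (0 : ℝ) 1 := fun s =>
    (projIcc (0 : ℝ) 1 zero_le_one s).2
  have hK : IsTonelli K :=
    { cont := hHcont.comp_continuous
        (f := fun p : ℝ × ℝ => ((projIcc (0 : ℝ) 1 zero_le_one p.1 : ℝ), p.2))
        ((continuous_subtype_val.comp (continuous_projIcc.comp continuous_fst)).prodMk
          continuous_snd) fun p => ⟨hproj _, mem_univ _⟩
      diff := fun s => (hHdiff _ (hproj s)).differentiable (by decide)
      conv := fun s => hHconv _ (hproj s)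
      superlinear := fun C => (hHsup C).imp fun R hR s => hR _ (hproj s) }
  have ha0 : a0 K = a0 H := congrArg sSup (image_congr fun s hs => by rw [hKH s hs])
  have hσ : ∀ a, sigmaFn K a = sigmaFn H a := fun a =>
    intervalIntegral.integral_congr fun s hs => by
      rw [uIcc_of_le zero_le_one] at hs
      simp only [sigmaPlus, hKH s hs]
  have hL : ∀ {ξ : ℝ → ℝ} (v : ℝ → ℝ), (∀ t ∈ Icc (0 : ℝ) T, ξ t ∈ Icc (0 : ℝ) 1) →
      EqOn (fun τ => fenchelL K (ξ τ) (v τ)) (fun τ => fenchelL H (ξ τ) (v τ)) (uIcc 0 T) :=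
    fun {ξ} v hξ τ hτ => by
      rw [uIcc_of_le hT.le] at hτ
      simp only [fenchelL, hKH _ (hξ τ hτ)]
  have hgr := hK.isGreatest_a0
  rw [ha0] at hgr
  have hmin : ∃ s ∈ Icc (0 : ℝ) 1, ∀ ρ, a0 H ≤ K s ρ := by
    obtain ⟨s, hs, h⟩ := hgr.1
    exact ⟨s, hs, fun ρ => h ▸ (hK.isLeast_sInf_range s).2 ⟨ρ, rfl⟩⟩
  have hA : ∀ s, ∃ ρ, K s ρ ≤ a0 H := fun s => by
    have h2 : K (projIcc 0 1 zero_le_one s) = K s := hKH _ (hproj s)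
    obtain ⟨ρ, hρ⟩ := (hK.isLeast_sInf_range s).1
    refine ⟨ρ, hρ.trans_le ?_⟩
    rw [← h2]
    exact hgr.2 ⟨_, hproj s, rfl⟩
  obtain ⟨a, ha, ξ, v, hac, h0, h1, hξ, hint, hval⟩ := hK.exists_minimizer hT hA hmin
  have hlow : ∀ b, a0 H ≤ b → ∀ {ξ v : ℝ → ℝ}, IsACOn ξ v 0 T → ξ 0 = 0 → ξ T = 1 →
      IntervalIntegrable (fun τ => fenchelL K (ξ τ) (v τ)) volume 0 T →
      sigmaFn H b - T * b ≤ ∫ τ in (0 : ℝ)..T, fenchelL K (ξ τ) (v τ) :=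
    fun b hb _ _ hac h0 h1 hi => hσ b ▸ hK.sub_le_action hT
      (fun s => (hA s).imp fun ρ hρ => hρ.trans hb) hac h0 h1 hi
  rw [hσ] at hval
  have hcurly : T * curlyL 𝓗 (sigmaFn H (a0 H)) (1 / T) = sigmaFn H a - T * a := by
    have : IsGreatest ((fun ρ => ρ * (1 / T) - 𝓗 ρ) '' Ici (sigmaFn H (a0 H)))
        (sigmaFn H a * (1 / T) - a) := by
      refine ⟨⟨sigmaFn H a, ?_, by simp only [h𝓗₁ a ha]⟩, forall_mem_image.2 fun ρ hρ => ?_⟩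
      · rw [mem_Ici, ← hσ, ← hσ]
        exact hK.sigmaFn_mono hA ha
      · have h := hlow _ (h𝓗₃ ρ hρ) hac h0 h1 hint
        rw [hval, h𝓗₂ ρ hρ] at h
        refine le_of_mul_le_mul_left ?_ hT
        field_simp
        linarith
    rw [curlyL, this.csSup_eq]
    field_simp
  rw [hcurly]
  constructor
  · refine ⟨ξ, v, hac, h0, h1, hξ,
      (intervalIntegrable_congr ((hL v hξ).mono uIoc_subset_uIcc)).1 hint, ?_⟩
    rw [← hval]
    exact intervalIntegral.integral_congr (hL v hξ)
  · rintro _ ⟨ζ, w, hac', h0', h1', hζ, hi, rfl⟩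
    rw [← intervalIntegral.integral_congr (hL w hζ)]
    exact hlow a ha hac' h0' h1' 
      ((intervalIntegrable_congr ((hL w hζ).mono uIoc_subset_uIcc)).2 hi)
end

section
/- Let g : ∂ₚ⁻Q → ℝ be uniformly continuous and define, for (s,t) ∈ [0,1] × (0,∞), w₀(s,t) := inf { g(s₀,t₀) + ∫_{t₀}^{t} L(η(τ), η̇(τ)) dτ }, where the infimum is over all (s₀,t₀) ∈ ∂ₚ⁻Q with t₀ < t and all absolutely continuous curves η : [t₀,t] → [0,1] with η(t₀) = s₀ and η(t) = s. Then w₀ is uniformly continuous on [0,1] × (0,∞), and hence extends to a uniformly continuous function on Q̄ = [0,1] × [0,∞). -/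
/-- The parabolic-type boundary
`∂ₚ⁻Q := ((0,1) × {0}) ∪ ({0} × [0,∞))` of `Q = (0,1) × (0,∞)`. -/
def lowerBoundary : Set (ℝ × ℝ) :=
  (Set.Ioo (0 : ℝ) 1 ×ˢ ({0} : Set ℝ)) ∪ (({0} : Set ℝ) ×ˢ Set.Ici (0 : ℝ))

/-- The Lax–Oleinik value function
`w₀(s,t) := inf { g(s₀,t₀) + ∫_{t₀}^t L(η,η̇) dτ }`, the infimum being over
points `(s₀,t₀) ∈ ∂ₚ⁻Q` with `t₀ < t` and absolutely continuous curves
`η : [t₀,t] → [0,1]` with `η(t₀) = s₀`, `η(t) = s`. -/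
noncomputable def w0 (L : ℝ → ℝ → ℝ) (g : ℝ × ℝ → ℝ) (p : ℝ × ℝ) : ℝ :=
  sInf {x : ℝ | ∃ s₀ t₀ : ℝ, ∃ η v : ℝ → ℝ,
    (s₀, t₀) ∈ lowerBoundary ∧ t₀ < p.2 ∧ IsACOn η v t₀ p.2 ∧
    η t₀ = s₀ ∧ η p.2 = p.1 ∧
    (∀ t ∈ Set.Icc t₀ p.2, η t ∈ Set.Icc (0 : ℝ) 1) ∧
    IntervalIntegrable (fun τ => L (η τ) (v τ)) MeasureTheory.volume t₀ p.2 ∧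
    x = g (s₀, t₀) + ∫ τ in t₀..p.2, L (η τ) (v τ)}

open MeasureTheory Set

/-- There is an absolutely continuous curve in `[0,1]` from `(x, a)` to `(y, b)` with action `A`. -/
def HasAction (L : ℝ → ℝ → ℝ) (a b x y A : ℝ) : Prop :=
  ∃ η v : ℝ → ℝ, IntervalIntegrable v volume a b ∧
    (∀ t ∈ Icc a b, η t = η a + ∫ τ in a..t, v τ) ∧ η a = x ∧ η b = y ∧
    (∀ t ∈ Icc a b, η t ∈ Icc (0 : ℝ) 1) ∧
    IntervalIntegrable (fun τ => L (η τ) (v τ)) volume a b ∧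
    A = ∫ τ in a..b, L (η τ) (v τ)

namespace HasAction

variable {L : ℝ → ℝ → ℝ} {a b c x y z A B : ℝ}

theorem left_mem (h : HasAction L a b x y A) (hab : a ≤ b) : x ∈ Icc (0 : ℝ) 1 := by
  obtain ⟨η, v, -, -, rfl, -, hm, -⟩ := h
  exact hm a ⟨le_rfl, hab⟩

theorem right_mem (h : HasAction L a b x y A) (hab : a ≤ b) : y ∈ Icc (0 : ℝ) 1 := by
  obtain ⟨η, v, -, -, -, rfl, hm, -⟩ := h
  exact hm b ⟨hab, le_rfl⟩

theorem translate (H : HasAction L a b x y A) (h : ℝ) :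
    HasAction L (a - h) (b - h) x y A := by
  obtain ⟨η, v, hv, hη, hx, hy, hm, hL, rfl⟩ := H
  refine ⟨fun τ => η (τ + h), fun τ => v (τ + h), hv.comp_add_right h, ?_, by simpa, by simpa,
    ?_, hL.comp_add_right h, ?_⟩
  · intro t ht
    have := hη (t + h) ⟨by linarith [ht.1], by linarith [ht.2]⟩
    rw [intervalIntegral.integral_comp_add_right (fun τ => v τ)]
    simpa using this
  · intro t ht
    exact hm (t + h) ⟨by linarith [ht.1], by linarith [ht.2]⟩
  · rw [intervalIntegral.integral_comp_add_right (fun τ => L (η τ) (v τ))]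
    simp

theorem trans (hab : a ≤ b) (hbc : b ≤ c) (H₁ : HasAction L a b x y A)
    (H₂ : HasAction L b c y z B) : HasAction L a c x z (A + B) := by
  obtain ⟨η₁, v₁, hv₁, hη₁, hx₁, hy₁, hm₁, hL₁, rfl⟩ := H₁
  obtain ⟨η₂, v₂, hv₂, hη₂, hx₂, hy₂, hm₂, hL₂, rfl⟩ := H₂
  set η : ℝ → ℝ := fun τ => if τ ≤ b then η₁ τ else η₂ τ with hη
  set v : ℝ → ℝ := fun τ => if τ ≤ b then v₁ τ else v₂ τ with hv
  have e₁ : ∀ τ, τ ≤ b → η τ = η₁ τ ∧ v τ = v₁ τ := fun τ h => by simp [hη, hv, h]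
  have e₂ : ∀ τ, b < τ → η τ = η₂ τ ∧ v τ = v₂ τ := fun τ h => by simp [hη, hv, h.not_ge]
  have ev₁ : ∀ t ∈ Icc a b, EqOn v₁ v (Set.uIoc a t) := by
    intro t ht τ hτ
    rw [uIoc_of_le ht.1] at hτ
    exact (e₁ τ (hτ.2.trans ht.2)).2.symm
  have ev₂ : ∀ t, b ≤ t → EqOn v₂ v (Set.uIoc b t) := by
    intro t ht τ hτ
    rw [uIoc_of_le ht] at hτ
    exact (e₂ τ hτ.1).2.symm
  have eL₁ : EqOn (fun τ => L (η₁ τ) (v₁ τ)) (fun τ => L (η τ) (v τ)) (Set.uIoc a b) := by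
    intro τ hτ
    rw [uIoc_of_le hab] at hτ
    simp only [(e₁ τ hτ.2).1, (e₁ τ hτ.2).2]
  have eL₂ : EqOn (fun τ => L (η₂ τ) (v₂ τ)) (fun τ => L (η τ) (v τ)) (Set.uIoc b c) := by
    intro τ hτ
    rw [uIoc_of_le hbc] at hτ
    simp only [(e₂ τ hτ.1).1, (e₂ τ hτ.1).2]
  have iv₁ := (intervalIntegrable_congr (μ := volume) (ev₁ b ⟨hab, le_rfl⟩)).1 hv₁
  have iv₂ := (intervalIntegrable_congr (μ := volume) (ev₂ c hbc)).1 hv₂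
  have iL₁ := (intervalIntegrable_congr (μ := volume) eL₁).1 hL₁
  have iL₂ := (intervalIntegrable_congr (μ := volume) eL₂).1 hL₂
  have intg : ∀ {f g : ℝ → ℝ} {p q : ℝ}, EqOn f g (Set.uIoc p q) →
      ∫ τ in p..q, f τ = ∫ τ in p..q, g τ := fun h =>
    intervalIntegral.integral_congr_ae (Filter.Eventually.of_forall h)
  have ea : η a = η₁ a := (e₁ a hab).1
  refine ⟨η, v, iv₁.trans iv₂, ?_, ea.trans hx₁, ?_, ?_, iL₁.trans iL₂, ?_⟩
  · intro t ht
    rcases le_or_gt t b with htb | htb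
    · rw [(e₁ t htb).1, ea, hη₁ t ⟨ht.1, htb⟩, intg (ev₁ t ⟨ht.1, htb⟩)]
    · have i₂ : IntervalIntegrable v volume b t := iv₂.mono_set (by
        rw [uIcc_of_le htb.le, uIcc_of_le hbc]; exact Icc_subset_Icc le_rfl ht.2)
      rw [(e₂ t htb).1, ea, hη₂ t ⟨htb.le, ht.2⟩, intg (ev₂ t htb.le), hx₂, ← hy₁,
        hη₁ b ⟨hab, le_rfl⟩, intg (ev₁ b ⟨hab, le_rfl⟩),
        ← intervalIntegral.integral_add_adjacent_intervals iv₁ i₂, add_assoc]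
  · rcases hbc.eq_or_lt with rfl | h
    · rw [(e₁ b le_rfl).1, hy₁, ← hx₂, hy₂]
    · rw [(e₂ c h).1, hy₂]
  · intro t ht
    rcases le_or_gt t b with htb | htb
    · rw [(e₁ t htb).1]; exact hm₁ t ⟨ht.1, htb⟩
    · rw [(e₂ t htb).1]; exact hm₂ t ⟨htb.le, ht.2⟩
  · rw [intg eL₁, intg eL₂, intervalIntegral.integral_add_adjacent_intervals iL₁ iL₂]

theorem exists_intermediate (hab : a ≤ b) (hbc : b ≤ c) (H : HasAction L a c x z A) :
    ∃ y A₁ A₂, HasAction L a b x y A₁ ∧ HasAction L b c y z A₂ ∧ A = A₁ + A₂ := by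
  obtain ⟨η, v, hv, hη, hx, hz, hm, hL, rfl⟩ := H
  have s₁ : uIcc a b ⊆ uIcc a c := by
    rw [uIcc_of_le hab, uIcc_of_le (hab.trans hbc)]; exact Icc_subset_Icc le_rfl hbc
  have s₂ : uIcc b c ⊆ uIcc a c := by
    rw [uIcc_of_le hbc, uIcc_of_le (hab.trans hbc)]; exact Icc_subset_Icc hab le_rfl
  refine ⟨η b, _, _, ⟨η, v, hv.mono_set s₁, fun t ht => hη t ⟨ht.1, ht.2.trans hbc⟩, hx, rfl,
      fun t ht => hm t ⟨ht.1, ht.2.trans hbc⟩, hL.mono_set s₁, rfl⟩,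
    ⟨η, v, hv.mono_set s₂, fun t ht => ?_, rfl, hz,
      fun t ht => hm t ⟨hab.trans ht.1, ht.2⟩, hL.mono_set s₂, rfl⟩,
    (intervalIntegral.integral_add_adjacent_intervals (hL.mono_set s₁) (hL.mono_set s₂)).symm⟩
  have s₃ : uIcc b t ⊆ uIcc b c := by
    rw [uIcc_of_le hbc, uIcc_of_le ht.1]; exact Icc_subset_Icc le_rfl ht.2
  rw [hη t ⟨hab.trans ht.1, ht.2⟩, hη b ⟨hab, hbc⟩, add_assoc,
    intervalIntegral.integral_add_adjacent_intervals (hv.mono_set s₁)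
      ((hv.mono_set s₂).mono_set s₃)]

/-- Coercivity of the Lagrangian bounds the action below by the displacement. -/
theorem le_action (hab : a ≤ b) {K M : ℝ} (hK : 0 ≤ K)
    (hKM : ∀ s ∈ Icc (0 : ℝ) 1, ∀ l, K * |l| - M ≤ L s l) (H : HasAction L a b x y A) :
    K * |y - x| - M * (b - a) ≤ A := by
  obtain ⟨η, v, hv, hη, rfl, rfl, hm, hL, rfl⟩ := H
  have h₁ : η b - η a = ∫ τ in a..b, v τ := by
    rw [hη b ⟨hab, le_rfl⟩]; ring
  have h₂ : ∫ τ in a..b, (K * |v τ| - M) ≤ ∫ τ in a..b, L (η τ) (v τ) :=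
    intervalIntegral.integral_mono_on hab
      ((hv.abs.const_mul K).sub intervalIntegrable_const) hL fun τ hτ => hKM _ (hm τ hτ) _
  rw [intervalIntegral.integral_sub (hv.abs.const_mul K) intervalIntegrable_const,
    intervalIntegral.integral_const_mul, intervalIntegral.integral_const, smul_eq_mul] at h₂
  have h₃ := intervalIntegral.abs_integral_le_integral_abs (f := v) (μ := volume) hab
  rw [← h₁] at h₃
  nlinarith [mul_le_mul_of_nonneg_left h₃ hK]

/-- Segments of slope at most one have action controlled by the elapsed time. -/
theorem exists_segment
    (hLcont : ContinuousOn (fun p : ℝ × ℝ => L p.1 p.2) (Icc (0 : ℝ) 1 ×ˢ univ)) {C : ℝ}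
    (hC : ∀ s ∈ Icc (0 : ℝ) 1, ∀ l, |l| ≤ 1 → L s l ≤ C) (hab : a < b)
    (hx : x ∈ Icc (0 : ℝ) 1) (hy : y ∈ Icc (0 : ℝ) 1) (hxy : |y - x| ≤ b - a) :
    ∃ A, HasAction L a b x y A ∧ A ≤ C * (b - a) := by
  have hpos : 0 < b - a := sub_pos.2 hab
  set k := (y - x) / (b - a) with hk
  have hk1 : |k| ≤ 1 := by
    rw [hk, abs_div, abs_of_pos hpos]; exact (div_le_one hpos).2 hxy
  have hkb : k * (b - a) = y - x := div_mul_cancel₀ _ hpos.ne'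
  set η : ℝ → ℝ := fun τ => x + k * (τ - a) with hη
  have hm : ∀ t ∈ Icc a b, η t ∈ Icc (0 : ℝ) 1 := by
    intro t ht
    have hmem := (convex_Icc (0 : ℝ) 1) hx hy (a := (b - t) / (b - a)) (b := (t - a) / (b - a))
      (div_nonneg (sub_nonneg.2 ht.2) hpos.le) (div_nonneg (sub_nonneg.2 ht.1) hpos.le)
      (by field_simp; ring)
    convert hmem using 1
    simp only [hη, hk, smul_eq_mul]
    field_simp
    ring
  have hL : ContinuousOn (fun τ => L (η τ) k) (Icc a b) :=
    hLcont.comp (f := fun τ => (η τ, k)) (by fun_prop) fun t ht => ⟨hm t ht, mem_univ _⟩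
  have hLi : IntervalIntegrable (fun τ => L (η τ) k) volume a b :=
    hL.intervalIntegrable_of_Icc hab.le
  refine ⟨_, ⟨η, fun _ => k, intervalIntegrable_const, ?_, by simp [hη], ?_, hm, hLi, rfl⟩, ?_⟩
  · intro t _
    simp [hη, mul_comm]
  · simp only [hη]; linarith
  · calc ∫ τ in a..b, L (η τ) k ≤ ∫ _ in a..b, C :=
          intervalIntegral.integral_mono_on hab.le hLi intervalIntegrable_const
            fun τ hτ => hC _ (hm τ hτ) _ hk1
      _ = C * (b - a) := by simp [mul_comm]

end HasAction

theorem exists_coercive_bound {L : ℝ → ℝ → ℝ}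
    (hLcont : ContinuousOn (fun p : ℝ × ℝ => L p.1 p.2) (Icc (0 : ℝ) 1 ×ˢ univ))
    (hLsup : ∀ C : ℝ, ∃ R : ℝ, ∀ s ∈ Icc (0 : ℝ) 1, ∀ l : ℝ, R ≤ |l| → C ≤ L s l / |l|)
    {K : ℝ} (hK : 0 ≤ K) :
    ∃ M, 0 ≤ M ∧ ∀ s ∈ Icc (0 : ℝ) 1, ∀ l, K * |l| - M ≤ L s l := by
  obtain ⟨R, hR⟩ := hLsup K
  set R' := max R 1
  obtain ⟨B, hB⟩ := (isCompact_Icc.prod isCompact_Icc :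
    IsCompact (Icc (0 : ℝ) 1 ×ˢ Icc (-R') R')).exists_bound_of_continuousOn
      (hLcont.mono (prod_mono_right (subset_univ _)))
  refine ⟨max 0 (K * R' + B), le_max_left _ _, fun s hs l => ?_⟩
  rcases le_total R' |l| with h | h
  · have hl : 0 < |l| := zero_lt_one.trans_le ((le_max_right _ _).trans h)
    have := (le_div_iff₀ hl).1 (hR s hs l ((le_max_left _ _).trans h))
    linarith [le_max_left 0 (K * R' + B)]
  · have h₁ := hB (s, l) ⟨hs, abs_le.1 h⟩
    have h₂ := (abs_le.1 (Real.norm_eq_abs _ ▸ h₁)).1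
    have h₃ := mul_le_mul_of_nonneg_left h hK
    simp only at h₂
    linarith [le_max_right 0 (K * R' + B)]

theorem exists_upper_bound_of_slope_le_one {L : ℝ → ℝ → ℝ}
    (hLcont : ContinuousOn (fun p : ℝ × ℝ => L p.1 p.2) (Icc (0 : ℝ) 1 ×ˢ univ)) :
    ∃ C, 0 ≤ C ∧ ∀ s ∈ Icc (0 : ℝ) 1, ∀ l, |l| ≤ 1 → L s l ≤ C := by
  obtain ⟨B, hB⟩ := (isCompact_Icc.prod isCompact_Icc :
    IsCompact (Icc (0 : ℝ) 1 ×ˢ Icc (-1 : ℝ) 1)).exists_bound_of_continuousOn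
      (hLcont.mono (prod_mono_right (subset_univ _)))
  refine ⟨max 0 B, le_max_left _ _, fun s hs l hl => ?_⟩
  exact (le_abs_self _).trans ((hB (s, l) ⟨hs, abs_le.1 hl⟩).trans (le_max_right _ _))

/-- A uniformly continuous function on a convex subset of the line grows at most linearly. -/
theorem UniformContinuousOn.exists_abs_sub_le_of_convex {G : ℝ → ℝ} {S : Set ℝ}
    (hS : Convex ℝ S) (hG : UniformContinuousOn G S) {ε : ℝ} (hε : 0 < ε) :
    ∃ K, 0 ≤ K ∧ ∀ x ∈ S, ∀ y ∈ S, |G x - G y| ≤ ε + K * |x - y| := by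
  obtain ⟨δ, hδ, h⟩ := Metric.uniformContinuousOn_iff.1 hG ε hε
  have key : ∀ n : ℕ, ∀ x ∈ S, ∀ y ∈ S, |x - y| < (n + 1) * δ →
      |G x - G y| ≤ (n + 1) * ε := by
    intro n
    induction n with
    | zero =>
      intro x hx y hy hxy
      have := h x hx y hy (by simpa [Real.dist_eq] using hxy)
      rw [Real.dist_eq] at this
      simpa using this.le
    | succ n ih =>
      intro x hx y hy hxy
      have hn : (0 : ℝ) < n + 1 + 1 := by positivity
      set r : ℝ := 1 / (n + 1 + 1)
      have hr : r * (n + 1 + 1) = 1 := by simp only [r]; field_simp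
      have hr0 : 0 ≤ r := by positivity
      have hr1 : r ≤ 1 := by nlinarith
      set z := (1 - r) * x + r * y
      have hz : z ∈ S := hS hx hy (sub_nonneg.2 hr1) hr0 (by ring)
      push_cast at hxy ⊢
      have h1 : |x - z| < δ := by
        have : x - z = r * (x - y) := by simp only [z]; ring
        rw [this, abs_mul, abs_of_nonneg hr0]
        have : 0 < r := by positivity
        calc r * |x - y| < r * ((n + 1 + 1) * δ) := by gcongr
          _ = δ := by rw [← mul_assoc, hr, one_mul]
      have h2 : |z - y| < (n + 1) * δ := by
        have : z - y = (1 - r) * (x - y) := by simp only [z]; ring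
        have h3 : 1 - r = r * (n + 1) := by linarith
        have : 0 < r := by positivity
        rw [‹z - y = _›, h3, abs_mul, abs_of_nonneg (by positivity)]
        calc r * (n + 1) * |x - y| < r * (n + 1) * ((n + 1 + 1) * δ) := by gcongr
          _ = r * (n + 1 + 1) * ((n + 1) * δ) := by ring
          _ = (n + 1) * δ := by rw [hr, one_mul]
      have h3 := h x hx z hz (by simpa [Real.dist_eq] using h1)
      rw [Real.dist_eq] at h3
      have h4 := ih z hz y hy h2
      have := abs_sub_le (G x) (G z) (G y)
      linarith
  refine ⟨ε / δ, by positivity, fun x hx y hy => ?_⟩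
  have hfl := Nat.lt_floor_add_one (|x - y| / δ)
  have hfl' := Nat.floor_le (show 0 ≤ |x - y| / δ by positivity)
  have := key ⌊|x - y| / δ⌋₊ x hx y hy ((div_lt_iff₀ hδ).1 hfl)
  calc |G x - G y| ≤ (⌊|x - y| / δ⌋₊ + 1) * ε := this
    _ ≤ (|x - y| / δ + 1) * ε := by gcongr
    _ = ε + ε / δ * |x - y| := by ring

theorem mem_lowerBoundary_iff {s t : ℝ} :
    (s, t) ∈ lowerBoundary ↔ (0 < s ∧ s < 1 ∧ t = 0) ∨ (s = 0 ∧ 0 ≤ t) := by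
  simp [lowerBoundary, and_assoc]

theorem exists_abs_sub_le_of_lowerBoundary {g : ℝ × ℝ → ℝ}
    (hg : UniformContinuousOn g lowerBoundary) {ε : ℝ} (hε : 0 < ε) :
    ∃ K, 0 ≤ K ∧ ∀ s t s' t', (s, t) ∈ lowerBoundary → (s', t') ∈ lowerBoundary →
      |g (s, t) - g (s', t')| ≤ ε + K * (|s - s'| + |t - t'|) := by
  set γ : ℝ → ℝ × ℝ := fun r => (max r 0, max (-r) 0) with hγ
  have hmaps : MapsTo γ (Iio 1) lowerBoundary := by
    intro r hr
    have hr : r < 1 := hr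
    rw [hγ, mem_lowerBoundary_iff]
    rcases le_or_gt r 0 with h | h
    · right; simp [h]
    · left; simp [h, hr, h.le]
  have hγu : UniformContinuous γ := by
    have h₁ : LipschitzWith 1 fun r : ℝ => max r 0 := LipschitzWith.id.max_const 0
    have h₂ : UniformContinuous fun r : ℝ => max (-r) 0 :=
      h₁.uniformContinuous.comp uniformContinuous_id.neg
    exact h₁.uniformContinuous.prodMk h₂
  have hG : UniformContinuousOn (g ∘ γ) (Iio 1) := hg.comp hγu.uniformContinuousOn hmaps
  obtain ⟨K, hK, h⟩ := hG.exists_abs_sub_le_of_convex (convex_Iio 1) hε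
  have hinv : ∀ s t, (s, t) ∈ lowerBoundary → s - t < 1 ∧ γ (s - t) = (s, t) := by
    intro s t hst
    rcases mem_lowerBoundary_iff.1 hst with ⟨h0, h1, rfl⟩ | ⟨rfl, h0⟩
    · simp [hγ, h0.le, h1]
    · simp [hγ, h0]; linarith
  refine ⟨K, hK, fun s t s' t' hp hq => ?_⟩
  obtain ⟨h₁, e₁⟩ := hinv s t hp
  obtain ⟨h₂, e₂⟩ := hinv s' t' hq
  have := h _ h₁ _ h₂
  rw [Function.comp_apply, Function.comp_apply, e₁, e₂] at this
  have habs : |s - t - (s' - t')| ≤ |s - s'| + |t - t'| := by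
    have := abs_sub (s - s') (t - t')
    rwa [show s - s' - (t - t') = s - t - (s' - t') by ring] at this
  linarith [mul_le_mul_of_nonneg_left habs hK]

/-- The values of all competitors in the definition of `w0`. -/
def competitorValues (L : ℝ → ℝ → ℝ) (g : ℝ × ℝ → ℝ) (s t : ℝ) : Set ℝ :=
  {x | ∃ s₀ t₀ A, (s₀, t₀) ∈ lowerBoundary ∧ t₀ < t ∧ HasAction L t₀ t s₀ s A ∧
    x = g (s₀, t₀) + A}

theorem w0_eq_sInf (L : ℝ → ℝ → ℝ) (g : ℝ × ℝ → ℝ) (s t : ℝ) :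
    w0 L g (s, t) = sInf (competitorValues L g s t) := by
  unfold w0 competitorValues
  congr 1
  ext x
  constructor
  · rintro ⟨s₀, t₀, η, v, hb, ht, hac, h₁, h₂, hm, hL, rfl⟩
    exact ⟨s₀, t₀, _, hb, ht, ⟨η, v,
      (intervalIntegrable_iff_integrableOn_Icc_of_le ht.le).2 hac.1, hac.2, h₁, h₂, hm, hL, rfl⟩,
      rfl⟩
  · rintro ⟨s₀, t₀, A, hb, ht, ⟨η, v, hv, hη, h₁, h₂, hm, hL, rfl⟩, rfl⟩
    exact ⟨s₀, t₀, η, v, hb, ht,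
      ⟨(intervalIntegrable_iff_integrableOn_Icc_of_le ht.le).1 hv, hη⟩, h₁, h₂, hm, hL, rfl⟩

section Value

variable {L : ℝ → ℝ → ℝ} {g : ℝ × ℝ → ℝ}

theorem bddBelow_competitorValues
    (hLcont : ContinuousOn (fun p : ℝ × ℝ => L p.1 p.2) (Icc (0 : ℝ) 1 ×ˢ univ))
    (hLsup : ∀ C : ℝ, ∃ R : ℝ, ∀ s ∈ Icc (0 : ℝ) 1, ∀ l : ℝ, R ≤ |l| → C ≤ L s l / |l|)
    (hg : UniformContinuousOn g lowerBoundary) (s t : ℝ) :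
    BddBelow (competitorValues L g s t) := by
  obtain ⟨M, hM, hKM⟩ := exists_coercive_bound hLcont hLsup le_rfl
  obtain ⟨K, hK, hgK⟩ := exists_abs_sub_le_of_lowerBoundary hg one_pos
  refine ⟨g (0, 0) - 1 - K * (1 + t) - M * t, ?_⟩
  rintro _ ⟨s₀, t₀, A, hb, ht, hA, rfl⟩
  have h₀ : (0 : ℝ) ≤ s₀ ∧ s₀ ≤ 1 ∧ 0 ≤ t₀ := by
    rcases mem_lowerBoundary_iff.1 hb with ⟨h0, h1, rfl⟩ | ⟨rfl, h0⟩
    · exact ⟨h0.le, h1.le, le_rfl⟩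
    · exact ⟨le_rfl, zero_le_one, h0⟩
  have h₁ := hgK 0 0 s₀ t₀ (mem_lowerBoundary_iff.2 (Or.inr ⟨rfl, le_rfl⟩)) hb
  rw [zero_sub, zero_sub, abs_neg, abs_neg, abs_of_nonneg h₀.1, abs_of_nonneg h₀.2.2] at h₁
  have h₂ := hA.le_action ht.le le_rfl hKM
  have h₃ : K * (s₀ + t₀) ≤ K * (1 + t) := by gcongr; exact h₀.2.1
  have h₄ : M * (t - t₀) ≤ M * t := by gcongr; linarith
  linarith [(abs_le.1 h₁).2]

/-- A segment of slope at most one joins the initial boundary to any point of positive time. -/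
theorem exists_competitor_of_segment
    (hLcont : ContinuousOn (fun p : ℝ × ℝ => L p.1 p.2) (Icc (0 : ℝ) 1 ×ˢ univ)) {C : ℝ}
    (hC : ∀ s ∈ Icc (0 : ℝ) 1, ∀ l, |l| ≤ 1 → L s l ≤ C) {s t : ℝ}
    (hs : s ∈ Icc (0 : ℝ) 1) (ht : 0 < t) :
    ∃ y A, (y, (0 : ℝ)) ∈ lowerBoundary ∧ |y - s| ≤ t ∧ HasAction L 0 t y s A ∧ A ≤ C * t := by
  have hy : |max 0 (s - t) - s| ≤ t := by
    rw [abs_le]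
    constructor
    · linarith [le_max_right 0 (s - t)]
    · have : max 0 (s - t) ≤ s + t := max_le (by linarith [hs.1]) (by linarith)
      linarith
  have hy₁ : max 0 (s - t) < 1 := max_lt zero_lt_one (by linarith [hs.2])
  obtain ⟨A, hA, hAC⟩ := HasAction.exists_segment hLcont hC ht
    (x := max 0 (s - t)) ⟨le_max_left _ _, hy₁.le⟩ hs (by rwa [abs_sub_comm, sub_zero])
  refine ⟨_, A, mem_lowerBoundary_iff.2 ?_, hy, hA, by simpa using hAC⟩
  rcases (le_max_left 0 (s - t)).eq_or_lt with h | h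
  · exact Or.inr ⟨h.symm, le_rfl⟩
  · exact Or.inl ⟨h, hy₁, rfl⟩

theorem nonempty_competitorValues
    (hLcont : ContinuousOn (fun p : ℝ × ℝ => L p.1 p.2) (Icc (0 : ℝ) 1 ×ˢ univ)) {s t : ℝ}
    (hs : s ∈ Icc (0 : ℝ) 1) (ht : 0 < t) : (competitorValues L g s t).Nonempty := by
  obtain ⟨C, -, hC⟩ := exists_upper_bound_of_slope_le_one hLcont
  obtain ⟨y, A, hy, -, hA, -⟩ := exists_competitor_of_segment hLcont hC hs ht
  exact ⟨_, y, 0, A, hy, ht, hA, rfl⟩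

/-- The dynamic programming inequality. -/
theorem w0_le_add_action
    (hLcont : ContinuousOn (fun p : ℝ × ℝ => L p.1 p.2) (Icc (0 : ℝ) 1 ×ˢ univ))
    (hLsup : ∀ C : ℝ, ∃ R : ℝ, ∀ s ∈ Icc (0 : ℝ) 1, ∀ l : ℝ, R ≤ |l| → C ≤ L s l / |l|)
    (hg : UniformContinuousOn g lowerBoundary) {a b x y A : ℝ} (ha : 0 < a) (hab : a ≤ b)
    (H : HasAction L a b x y A) : w0 L g (y, b) ≤ w0 L g (x, a) + A := by
  rw [w0_eq_sInf, w0_eq_sInf, ← sub_le_iff_le_add]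
  refine le_csInf (nonempty_competitorValues hLcont (H.left_mem hab) ha) ?_
  rintro _ ⟨s₀, t₀, B, hb, ht, hB, rfl⟩
  rw [sub_le_iff_le_add]
  exact csInf_le (bddBelow_competitorValues hLcont hLsup hg y b)
    ⟨s₀, t₀, B + A, hb, ht.trans_le hab, hB.trans ht.le hab H, by ring⟩

/-- Moving the final time slightly backwards does not increase the value much. -/
theorem exists_w0_le_w0_later
    (hLcont : ContinuousOn (fun p : ℝ × ℝ => L p.1 p.2) (Icc (0 : ℝ) 1 ×ˢ univ))
    (hLsup : ∀ C : ℝ, ∃ R : ℝ, ∀ s ∈ Icc (0 : ℝ) 1, ∀ l : ℝ, R ≤ |l| → C ≤ L s l / |l|)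
    (hg : UniformContinuousOn g lowerBoundary) {ε : ℝ} (hε : 0 < ε) :
    ∃ δ > 0, ∀ s ∈ Icc (0 : ℝ) 1, ∀ t > 0, ∀ h, 0 < h → h ≤ δ →
      w0 L g (s, t) ≤ w0 L g (s, t + h) + ε := by
  obtain ⟨K, hK, hgK⟩ := exists_abs_sub_le_of_lowerBoundary hg (half_pos hε)
  obtain ⟨M, hM, hKM⟩ := exists_coercive_bound hLcont hLsup hK
  obtain ⟨C, hC0, hC⟩ := exists_upper_bound_of_slope_le_one hLcont
  have hD : 0 < 2 * K + 2 * M + C + 1 := by positivity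
  refine ⟨ε / 2 / (2 * K + 2 * M + C + 1), by positivity, fun s hs t ht h hh hhδ => ?_⟩
  rw [le_div_iff₀ hD] at hhδ
  have hKh : 0 ≤ K * h := by positivity
  have hMh : 0 ≤ M * h := by positivity
  have hCh : 0 ≤ C * h := by positivity
  rw [w0_eq_sInf L g s (t + h), ← sub_le_iff_le_add]
  refine le_csInf (nonempty_competitorValues hLcont hs (by positivity)) ?_
  rintro _ ⟨s₀, t₀, A, hb, ht₀, hA, rfl⟩
  rw [sub_le_iff_le_add]
  have ht₀nn : 0 ≤ t₀ := by
    rcases mem_lowerBoundary_iff.1 hb with ⟨-, -, rfl⟩ | ⟨-, h0⟩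
    exacts [le_rfl, h0]
  rcases le_or_gt h t₀ with hcase | hcase
  · obtain rfl : s₀ = 0 := by
      rcases mem_lowerBoundary_iff.1 hb with ⟨-, -, rfl⟩ | ⟨h0, -⟩
      · exact absurd hcase hh.not_ge
      · exact h0
    have hb' : ((0 : ℝ), t₀ - h) ∈ lowerBoundary :=
      mem_lowerBoundary_iff.2 (Or.inr ⟨rfl, sub_nonneg.2 hcase⟩)
    have hA' := hA.translate h
    rw [add_sub_cancel_right] at hA'
    have hle : w0 L g (s, t) ≤ g (0, t₀ - h) + A := by
      rw [w0_eq_sInf]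
      exact csInf_le (bddBelow_competitorValues hLcont hLsup hg s t)
        ⟨0, t₀ - h, A, hb', by linarith, hA', rfl⟩
    have hgd := hgK _ _ _ _ hb' hb
    rw [sub_self, abs_zero, zero_add, sub_sub_cancel_left, abs_neg, abs_of_pos hh] at hgd
    linarith [(abs_le.1 hgd).2]
  · set m := min h t
    have hm : 0 < m := lt_min hh ht
    have hmh : m ≤ h := min_le_left _ _
    have hmt : m ≤ t := min_le_right _ _
    obtain ⟨z, A₁, A₂, hA₁, hA₂, rfl⟩ :=
      hA.exists_intermediate (b := m + h) (by linarith) (by linarith)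
    have hz := hA₁.right_mem (by linarith)
    have hA₂' := hA₂.translate h
    rw [add_sub_cancel_right, add_sub_cancel_right] at hA₂'
    obtain ⟨y, B, hy, hyz, hB, hBC⟩ := exists_competitor_of_segment hLcont hC hz hm
    have h₁ := w0_le_add_action hLcont hLsup hg hm hmt hA₂'
    have h₂ : w0 L g (z, m) ≤ g (y, 0) + B := by
      rw [w0_eq_sInf]
      exact csInf_le (bddBelow_competitorValues hLcont hLsup hg z m)
        ⟨y, 0, B, hy, hm, hB, rfl⟩
    have h₃ := hA₁.le_action (by linarith) hK hKM
    have h₄ := hgK _ _ _ _ hy hb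
    have h₅ : |y - s₀| + |0 - t₀| ≤ |z - s₀| + 2 * h := by
      rw [zero_sub, abs_neg, abs_of_nonneg ht₀nn]
      linarith [abs_sub_le y z s₀]
    have h₆ := mul_le_mul_of_nonneg_left h₅ hK
    have h₇ : C * m ≤ C * h := by gcongr
    have h₈ : M * (m + h - t₀) ≤ M * (2 * h) := by gcongr; linarith
    linarith [(abs_le.1 h₄).2]

theorem uniformContinuousOn_w0
    (hLcont : ContinuousOn (fun p : ℝ × ℝ => L p.1 p.2) (Icc (0 : ℝ) 1 ×ˢ univ))
    (hLsup : ∀ C : ℝ, ∃ R : ℝ, ∀ s ∈ Icc (0 : ℝ) 1, ∀ l : ℝ, R ≤ |l| → C ≤ L s l / |l|)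
    (hg : UniformContinuousOn g lowerBoundary) :
    UniformContinuousOn (w0 L g) (Icc (0 : ℝ) 1 ×ˢ Ioi (0 : ℝ)) := by
  rw [Metric.uniformContinuousOn_iff]
  intro ε hε
  obtain ⟨δ, hδ, hback⟩ := exists_w0_le_w0_later hLcont hLsup hg (ε := ε / 3) (by positivity)
  obtain ⟨C, hC0, hC⟩ := exists_upper_bound_of_slope_le_one hLcont
  set d := min (δ / 2) (ε / 3 / (3 * (C + 1))) with hd
  have hdpos : 0 < d := lt_min (by positivity) (by positivity)
  have hdδ : 2 * d ≤ δ := by linarith [min_le_left (δ / 2) (ε / 3 / (3 * (C + 1)))]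
  have hdC : C * (3 * d) ≤ ε / 3 := by
    have := (le_div_iff₀ (show 0 < 3 * (C + 1) by positivity)).1
      (min_le_right (δ / 2) (ε / 3 / (3 * (C + 1))))
    rw [← hd] at this
    linarith
  have key : ∀ s t s' t' : ℝ, s ∈ Icc (0 : ℝ) 1 → 0 < t → s' ∈ Icc (0 : ℝ) 1 → 0 < t' →
      |s - s'| < d → |t - t'| < d → w0 L g (s', t') < w0 L g (s, t) + ε := by
    intro s t s' t' hs ht hs' ht' hss htt
    rw [abs_lt] at htt
    have h₁ := hback s' hs' t' ht' (2 * d) (by positivity) hdδ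
    obtain ⟨A, hA, hAC⟩ := HasAction.exists_segment hLcont hC
      (a := t) (b := t' + 2 * d) (by linarith) hs hs' (by rw [abs_sub_comm]; linarith)
    have h₂ := w0_le_add_action hLcont hLsup hg ht (by linarith) hA
    have h₃ : C * (t' + 2 * d - t) ≤ C * (3 * d) := by gcongr; linarith
    linarith
  refine ⟨d, hdpos, ?_⟩
  rintro ⟨s, t⟩ ⟨hs, ht⟩ ⟨s', t'⟩ ⟨hs', ht'⟩ hdist
  rw [Prod.dist_eq, max_lt_iff, Real.dist_eq, Real.dist_eq] at hdist
  rw [Real.dist_eq, abs_sub_lt_iff]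
  have h₁ := key s t s' t' hs ht hs' ht' hdist.1 hdist.2
  have h₂ := key s' t' s t hs' ht' hs ht (by rw [abs_sub_comm]; exact hdist.1)
    (by rw [abs_sub_comm]; exact hdist.2)
  constructor <;> linarith

end Value

theorem UniformContinuousOn.exists_extension_closure {α β : Type*} [UniformSpace α]
    [UniformSpace β] [CompleteSpace β] [T0Space β] [Inhabited β] {f : α → β} {S : Set α}
    (hf : UniformContinuousOn f S) :
    ∃ F : α → β, UniformContinuousOn F (closure S) ∧ ∀ x ∈ S, F x = f x := by
  classical
  have hi : IsUniformInducing (inclusion (subset_closure (s := S))) :=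
    (isUniformEmbedding_set_inclusion subset_closure).isUniformInducing
  have hd : DenseRange (inclusion (subset_closure (s := S))) :=
    (denseRange_inclusion_iff subset_closure).2 subset_rfl
  have hfu : UniformContinuous (S.domRestrict f) := uniformContinuousOn_iff_restrict.1 hf
  set ψ := (hi.isDenseInducing hd).extend (S.domRestrict f)
  refine ⟨fun x => if h : x ∈ closure S then ψ ⟨x, h⟩ else default, ?_, fun x hx => ?_⟩
  · rw [uniformContinuousOn_iff_restrict]
    convert uniformContinuous_uniformly_extend hi hd hfu using 1
    ext x
    simp [ψ, x.2]
  · simp only [dif_pos (subset_closure hx)]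
    exact uniformly_extend_of_ind hi hd hfu ⟨x, hx⟩

/-- for a uniformly continuous datum `g` on `∂ₚ⁻Q`, the value
function `w₀` is uniformly continuous on `[0,1] × (0,∞)`, and hence extends to
a uniformly continuous function on `Q̄ = [0,1] × [0,∞)`. -/
theorem stmt18 (L : ℝ → ℝ → ℝ)
    (hLcont : ContinuousOn (fun p : ℝ × ℝ => L p.1 p.2)
      (Set.Icc (0 : ℝ) 1 ×ˢ (Set.univ : Set ℝ)))
    (hLdiff : ∀ s ∈ Set.Icc (0 : ℝ) 1, ContDiff ℝ 1 (L s))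
    (hLconv : ∀ s ∈ Set.Icc (0 : ℝ) 1, StrictConvexOn ℝ (Set.univ : Set ℝ) (L s))
    (hLsup : ∀ C : ℝ, ∃ R : ℝ, ∀ s ∈ Set.Icc (0 : ℝ) 1, ∀ lam : ℝ,
      R ≤ |lam| → C ≤ L s lam / |lam|)
    (g : ℝ × ℝ → ℝ)
    (hg : UniformContinuousOn g lowerBoundary) :
    UniformContinuousOn (w0 L g) (Set.Icc (0 : ℝ) 1 ×ˢ Set.Ioi (0 : ℝ)) ∧
    ∃ w : ℝ × ℝ → ℝ,
      UniformContinuousOn w (Set.Icc (0 : ℝ) 1 ×ˢ Set.Ici (0 : ℝ)) ∧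
      ∀ p ∈ Set.Icc (0 : ℝ) 1 ×ˢ Set.Ioi (0 : ℝ), w p = w0 L g p := by
  have h := uniformContinuousOn_w0 hLcont hLsup hg
  refine ⟨h, ?_⟩
  obtain ⟨w, hw, hwe⟩ := h.exists_extension_closure
  rw [closure_prod_eq, closure_Icc, closure_Ioi] at hw
  exact ⟨w, hw, hwe⟩
end
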